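/- Every Z₂-acyclic simplicial complex with at most 7 vertices is collapsible. -/

import Mathlib

/- Formalization of definitions from:
   B. Bagchi, B. Datta, "Combinatorial triangulations of homology spheres". -/

open Finset

noncomputable section

attribute [local instance] Classical.propDecidable

namespace HomologySpheres

variable {V : Type*} [DecidableEq V] {W : Type*} [DecidableEq W]

/-- The vertex set of a finite family of finite sets. -/
def verts (K : Finset (Finset V)) : Finset V := K.sup id

/-- An (abstract, finite) simplicial complex: a nonempty collection of nonempty
finite sets closed under taking nonempty subsets. -/
def IsComplex (K : Finset (Finset V)) : Prop :=
  K.Nonempty ∧ ∅ ∉ K ∧ ∀ s ∈ K, ∀ t : Finset V, t ⊆ s → t.Nonempty → t ∈ K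

/-- The facets (maximal faces) of `K`. -/
def facets (K : Finset (Finset V)) : Finset (Finset V) :=
  K.filter fun s => ∀ t ∈ K, s ⊆ t → t = s

/-- `K` is pure of dimension `d`: every maximal face has `d + 1` vertices. -/
def IsPure (d : ℕ) (K : Finset (Finset V)) : Prop :=
  ∀ s ∈ facets K, s.card = d + 1

/-- The link of a face `σ` in `K`. -/
def link (K : Finset (Finset V)) (σ : Finset V) : Finset (Finset V) :=
  K.filter fun τ => Disjoint τ σ ∧ τ ∪ σ ∈ K

/-- `L` is an induced (full) subcomplex of `K`. -/
def IsInduced (K L : Finset (Finset V)) : Prop :=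
  L ⊆ K ∧ ∀ s ∈ K, s ⊆ verts L → s ∈ L

/-- The simplicial complement `C(L, K)`: the induced subcomplex of `K` on
`V(K) \ V(L)`. -/
def simpComplement (L K : Finset (Finset V)) : Finset (Finset V) :=
  K.filter fun s => s ⊆ verts K \ verts L

/-- The simplicial neighbourhood `N(L, K)`: the subcomplex of `K` whose maximal
faces are the maximal faces of `K` meeting `V(L)`. -/
def simpNbhd (L K : Finset (Finset V)) : Finset (Finset V) :=
  K.filter fun s => ∃ t ∈ facets K, s ⊆ t ∧ (t ∩ verts L).Nonempty

/-- `fvec K i` is the number of `i`-dimensional faces of `K`. -/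
def fvec (K : Finset (Finset V)) (i : ℕ) : ℕ :=
  (K.filter fun s => s.card = i + 1).card

/-- The number of facets of cardinality `d + 1` containing a given `(d-1)`-face
(the degree of the face in a (weak) pseudomanifold of dimension `d`). -/
def degOf (K : Finset (Finset V)) (d : ℕ) (s : Finset V) : ℕ :=
  (K.filter fun t => s ⊆ t ∧ t.card = d + 1).card

/-- Simplicial isomorphism (via a vertex bijection carrying faces to faces). -/
def Iso (K : Finset (Finset V)) (L : Finset (Finset W)) : Prop :=
  ∃ f : V → W, Set.InjOn f ↑(verts K) ∧ L = K.image (Finset.image f)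

/-- The join of two simplicial complexes (on disjoint vertex sets). -/
def sjoin (K L : Finset (Finset V)) : Finset (Finset V) :=
  K ∪ L ∪ (K ×ˢ L).image fun p => p.1 ∪ p.2

/-- The standard ball on vertex set `A`: all nonempty subsets of `A`. -/
def stdBall (A : Finset V) : Finset (Finset V) := A.powerset.erase ∅

/-- The standard sphere on vertex set `A`: all nonempty proper subsets of `A`. -/
def stdSphere (A : Finset V) : Finset (Finset V) := (A.powerset.erase ∅).erase A

/-- `τ` is a free face of `K`, with `σ` the unique face properly containing it. -/
def IsFreeFace (K : Finset (Finset V)) (τ σ : Finset V) : Prop :=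
  τ ∈ K ∧ σ ∈ K ∧ τ ⊂ σ ∧ ∀ ρ ∈ K, τ ⊂ ρ → ρ = σ

/-- An elementary collapse removes a free face together with the unique face
properly containing it. -/
def ElemCollapse (K K' : Finset (Finset V)) : Prop :=
  ∃ τ σ : Finset V, IsFreeFace K τ σ ∧ K' = (K.erase τ).erase σ

/-- `K` collapses to `L` by a sequence of elementary collapses. -/
def CollapsesTo (K L : Finset (Finset V)) : Prop :=
  Relation.ReflTransGen ElemCollapse K L

/-- `K` is collapsible: it collapses to a single vertex. -/
def Collapsible (K : Finset (Finset V)) : Prop :=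
  ∃ v : V, CollapsesTo K {{v}}

/-! ### Simplicial homology with `ℤ/2` coefficients (augmented chain complex).
A chain of level `n` is a `ZMod 2`-valued function supported on the faces of
cardinality `n` (the empty set, of cardinality `0`, serves as the `(-1)`-simplex
of the augmented complex).  Reduced homology in dimension `q` lives at level
`q + 1`. -/

/-- `c` is a chain of level `n` of `K` (over `ℤ/2`). -/
def z2chainOK (K : Finset (Finset V)) (n : ℕ) (c : Finset V → ZMod 2) : Prop :=
  ∀ s : Finset V, c s ≠ 0 → s.card = n ∧ (s ∈ K ∨ s = ∅)

/-- The mod-2 boundary operator. -/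
def z2bdry (K : Finset (Finset V)) (c : Finset V → ZMod 2) : Finset V → ZMod 2 :=
  fun t => ∑ v ∈ verts K \ t, c (insert v t)

/-- `K` is `ℤ/2`-acyclic: all reduced homology with `ℤ/2` coefficients vanishes,
i.e. in the augmented mod-2 chain complex every cycle is a boundary. -/
def Z2Acyclic (K : Finset (Finset V)) : Prop :=
  ∀ (n : ℕ) (c : Finset V → ZMod 2), z2chainOK K n c → z2bdry K c = 0 →
    ∃ c', z2chainOK K (n + 1) c' ∧ z2bdry K c' = c

/-- `K` has the reduced `ℤ/2`-homology of the `d`-sphere: reduced homology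
vanishes in all dimensions except `d` (level `d + 1`), where it is `ℤ/2`
(there is a cycle `z` which is not a boundary, and modulo boundaries every
cycle is `0` or `z`). -/
def Z2HomologySphere (d : ℕ) (K : Finset (Finset V)) : Prop :=
  (∀ (n : ℕ) (c : Finset V → ZMod 2), n ≠ d + 1 → z2chainOK K n c →
    z2bdry K c = 0 → ∃ c', z2chainOK K (n + 1) c' ∧ z2bdry K c' = c) ∧
  (∃ z : Finset V → ZMod 2, z2chainOK K (d + 1) z ∧ z2bdry K z = 0 ∧
    (∀ c', z2chainOK K (d + 2) c' → z2bdry K c' ≠ z) ∧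
    (∀ z', z2chainOK K (d + 1) z' → z2bdry K z' = 0 →
      (∃ c', z2chainOK K (d + 2) c' ∧ z2bdry K c' = z') ∨
      (∃ c', z2chainOK K (d + 2) c' ∧ z2bdry K c' = z + z')))

/-! ### Integral simplicial homology via ordered chains (Munkres §13: ordered
simplicial homology, allowing repeated vertices, agrees with simplicial
homology). An ordered `m`-tuple chain corresponds to dimension `m - 1`; the
unique `0`-tuple is the `(-1)`-simplex of the augmented complex. -/

/-- `c` is an ordered chain of `K` over `ℤ`: supported on tuples whose image is
a face (the empty tuple being allowed in level `0`). -/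
def zchainOK (K : Finset (Finset V)) {m : ℕ} (c : (Fin m → V) → ℤ) : Prop :=
  ∀ x : Fin m → V, c x ≠ 0 → (Finset.univ.image x ∈ K ∨ m = 0)

/-- The integral boundary operator on ordered chains. -/
def zbdry (K : Finset (Finset V)) {m : ℕ} (c : (Fin (m + 1) → V) → ℤ) :
    (Fin m → V) → ℤ :=
  fun y => ∑ i : Fin (m + 1), (-1 : ℤ) ^ (i : ℕ) * ∑ v ∈ verts K, c (i.insertNth v y)

/-- `K` has the reduced integral homology of the `d`-sphere: reduced homology
vanishes in all dimensions except `d`, where it is infinite cyclic (there is a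
cycle `z` such that every cycle is, modulo boundaries, a unique multiple of `z`). -/
def ZHomologySphere (d : ℕ) (K : Finset (Finset V)) : Prop :=
  (∀ c : (Fin 0 → V) → ℤ, ∃ c' : (Fin 1 → V) → ℤ, zchainOK K c' ∧ zbdry K c' = c) ∧
  (∀ (m : ℕ) (c : (Fin (m + 1) → V) → ℤ), m ≠ d → zchainOK K c → zbdry K c = 0 →
    ∃ c' : (Fin (m + 2) → V) → ℤ, zchainOK K c' ∧ zbdry K c' = c) ∧
  (∃ z : (Fin (d + 1) → V) → ℤ, zchainOK K z ∧ zbdry K z = 0 ∧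
    ∀ z' : (Fin (d + 1) → V) → ℤ, zchainOK K z' → zbdry K z' = 0 →
      ∃! k : ℤ, ∃ c'' : (Fin (d + 2) → V) → ℤ,
        zchainOK K c'' ∧ zbdry K c'' = z' - k • z)

/-- A weak pseudomanifold of dimension `d`: pure, and every `(d-1)`-face is in
exactly two facets. -/
def IsWeakPseudomanifold (d : ℕ) (K : Finset (Finset V)) : Prop :=
  IsComplex K ∧ IsPure d K ∧ ∀ s ∈ K, s.card = d → degOf K d s = 2

/-- Adjacency of facets along a common `(d-1)`-face. -/
def FacetAdj (d : ℕ) (K : Finset (Finset V)) (s t : Finset V) : Prop :=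
  s ∈ K ∧ t ∈ K ∧ s.card = d + 1 ∧ t.card = d + 1 ∧ (s ∩ t).card = d

/-- A pseudomanifold: a weak pseudomanifold in which any two facets are joined
by a chain of facets, consecutive ones sharing a `(d-1)`-face. -/
def IsPseudomanifold (d : ℕ) (K : Finset (Finset V)) : Prop :=
  IsWeakPseudomanifold d K ∧ ∀ s ∈ K, ∀ t ∈ K, s.card = d + 1 → t.card = d + 1 →
    Relation.ReflTransGen (FacetAdj d K) s t

/-- A weak pseudomanifold with boundary. -/
def IsWeakPseudomanifoldWithBdry (d : ℕ) (K : Finset (Finset V)) : Prop :=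
  IsComplex K ∧ IsPure d K ∧
  (∀ s ∈ K, s.card = d → degOf K d s = 1 ∨ degOf K d s = 2) ∧
  (∃ s ∈ K, s.card = d ∧ degOf K d s = 1)

/-- The boundary complex: all faces of degree-one `(d-1)`-faces. -/
def bdryComplex (d : ℕ) (K : Finset (Finset V)) : Finset (Finset V) :=
  K.filter fun t => ∃ s ∈ K, t ⊆ s ∧ s.card = d ∧ degOf K d s = 1

/-- `K` is connected (any two vertices joined by a path of edges). -/
def SConnected (K : Finset (Finset V)) : Prop :=
  ∀ u ∈ verts K, ∀ v ∈ verts K,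
    Relation.ReflTransGen (fun a b : V => ({a, b} : Finset V) ∈ K) u v

/-! ### Geometric realizations, subdivisions and combinatorial equivalence. -/

/-- A geometric simplicial complex in `ℝ^ℕ`: finitely many geometric simplices
(affinely independent vertex sets), closed under faces, any two of which meet
in a common face. -/
structure GComplex where
  faces : Finset (Finset (ℕ → ℝ))
  nonempty : faces.Nonempty
  empty_not_mem : ∅ ∉ faces
  down_closed : ∀ s ∈ faces, ∀ t : Finset (ℕ → ℝ), t ⊆ s → t.Nonempty → t ∈ faces
  indep : ∀ s ∈ faces,
    AffineIndependent ℝ (fun x : {y : ℕ → ℝ // y ∈ s} => (x : ℕ → ℝ))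
  glue : ∀ s ∈ faces, ∀ t ∈ faces,
    convexHull ℝ (s : Set (ℕ → ℝ)) ∩ convexHull ℝ (t : Set (ℕ → ℝ)) =
      convexHull ℝ ((s ∩ t : Finset (ℕ → ℝ)) : Set (ℕ → ℝ))

/-- The geometric carrier (underlying polyhedron) of a geometric complex. -/
def GComplex.carrier (G : GComplex) : Set (ℕ → ℝ) :=
  ⋃ s ∈ G.faces, convexHull ℝ (s : Set (ℕ → ℝ))

/-- `G` realizes the abstract complex `K` via the vertex map `f`. -/
def RealizesMap (G : GComplex) (K : Finset (Finset V)) (f : V → ℕ → ℝ) : Prop :=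
  Set.InjOn f ↑(verts K) ∧ G.faces = K.image (Finset.image f)

/-- `G` is a geometric realization of the abstract complex `K`. -/
def Realizes (G : GComplex) (K : Finset (Finset V)) : Prop :=
  ∃ f : V → ℕ → ℝ, RealizesMap G K f

/-- `G'` is a subdivision of `G`: same carrier, and every simplex of `G'` is
contained in a simplex of `G`. -/
def Subdivides (G' G : GComplex) : Prop :=
  G'.carrier = G.carrier ∧
  ∀ s ∈ G'.faces, ∃ t ∈ G.faces,
    convexHull ℝ (s : Set (ℕ → ℝ)) ⊆ convexHull ℝ (t : Set (ℕ → ℝ))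

/-- Combinatorial equivalence: `K` and `L` admit isomorphic subdivisions. -/
def CombEquiv (K : Finset (Finset V)) (L : Finset (Finset W)) : Prop :=
  ∃ G1 G1' G2 G2' : GComplex, Realizes G1 K ∧ Realizes G2 L ∧
    Subdivides G1' G1 ∧ Subdivides G2' G2 ∧ Iso G1'.faces G2'.faces

/-- A combinatorial `d`-ball: combinatorially equivalent to the standard ball. -/
def IsCombBall (d : ℕ) (K : Finset (Finset V)) : Prop :=
  ∃ A : Finset ℕ, A.card = d + 1 ∧ CombEquiv K (stdBall A)

/-- A combinatorial `d`-sphere: combinatorially equivalent to the standard sphere. -/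
def IsCombSphere (d : ℕ) (K : Finset (Finset V)) : Prop :=
  ∃ A : Finset ℕ, A.card = d + 2 ∧ CombEquiv K (stdSphere A)

/-- A combinatorial `d`-manifold: every vertex link is a combinatorial
`(d-1)`-sphere. -/
def IsCombManifold (d : ℕ) (K : Finset (Finset V)) : Prop :=
  IsComplex K ∧ ∀ v ∈ verts K, IsCombSphere (d - 1) (link K {v})

/-- A combinatorial `d`-manifold with boundary. -/
def IsCombManifoldWithBdry (d : ℕ) (K : Finset (Finset V)) : Prop :=
  IsComplex K ∧
  (∀ v ∈ verts K, IsCombSphere (d - 1) (link K {v}) ∨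
    IsCombBall (d - 1) (link K {v})) ∧
  (∃ v ∈ verts K, IsCombBall (d - 1) (link K {v}))

/-- A pl `k`-ball: a polyhedron carried by some geometric complex whose face
structure is a combinatorial `k`-ball. -/
def IsPLBall (k : ℕ) (P : Set (ℕ → ℝ)) : Prop :=
  ∃ G : GComplex, G.carrier = P ∧ IsCombBall k G.faces

/-- Elementary polyhedral collapse: `P = P' ∪ B` with `B` a pl `k`-ball and
`P' ∩ B` a pl `(k-1)`-ball. -/
def PolyElemCollapse (P P' : Set (ℕ → ℝ)) : Prop :=
  ∃ k : ℕ, 1 ≤ k ∧ ∃ B : Set (ℕ → ℝ),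
    IsPLBall k B ∧ P = P' ∪ B ∧ IsPLBall (k - 1) (P' ∩ B)

/-- Polyhedral collapse. -/
def PolyCollapsesTo (P Q : Set (ℕ → ℝ)) : Prop :=
  Relation.ReflTransGen PolyElemCollapse P Q

/-- Carrier of a subcomplex under a vertex realization map `f`. -/
def subCarrier (f : V → ℕ → ℝ) (L : Finset (Finset V)) : Set (ℕ → ℝ) :=
  ⋃ s ∈ L, convexHull ℝ ((s.image f : Finset (ℕ → ℝ)) : Set (ℕ → ℝ))

/-! ### Bistellar moves. -/

/-- The core `β = {x ∈ A : A \ {x} ∈ X}` of a `(d+2)`-set `A`. -/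
def bcore (X : Finset (Finset V)) (A : Finset V) : Finset V :=
  A.filter fun x => A.erase x ∈ X

/-- `κ_A` is a bistellar `i`-move on the `d`-dimensional complex `X`:
`A` has `d + 2` elements and contains at least one and at most `d + 1` facets
of `X`; with `β` the core of `A` and `α = A \ β` an `i`-face of `X`, one has
`β ∉ X`, and either `α` is a facet of `X` or `Lk_X(α)` has vertex set `β`. -/
def BistellarIMove (d i : ℕ) (X : Finset (Finset V)) (A : Finset V) : Prop :=
  A.card = d + 2 ∧
  0 < ((facets X).filter fun σ => σ ⊆ A).card ∧
  ((facets X).filter fun σ => σ ⊆ A).card ≤ d + 1 ∧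
  bcore X A ∉ X ∧
  A \ bcore X A ∈ X ∧ (A \ bcore X A).card = i + 1 ∧
  (A \ bcore X A ∈ facets X ∨ verts (link X (A \ bcore X A)) = bcore X A)

/-! ### The explicit small complexes of the paper. -/

/-- The complex generated by a list of facets: all nonempty subsets thereof. -/
def genBy (F : Finset (Finset ℕ)) : Finset (Finset ℕ) :=
  F.sup fun s => s.powerset.erase ∅

/-- The standard 2-sphere `S²₄`. -/
def S24 : Finset (Finset ℕ) := stdSphere {1, 2, 3, 4}

/-- The join `S¹₃ * S⁰₂`. -/
def S13S02 : Finset (Finset ℕ) := sjoin (stdSphere {1, 2, 3}) (stdSphere {4, 5})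

/-- The octahedron `S⁰₂ * S⁰₂ * S⁰₂`. -/
def Octa : Finset (Finset ℕ) :=
  sjoin (stdSphere {1, 2}) (sjoin (stdSphere {3, 4}) (stdSphere {5, 6}))

/-- The 6-vertex real projective plane `ℝP²₆`. -/
def RP26 : Finset (Finset ℕ) :=
  genBy {{1, 2, 3}, {1, 2, 4}, {1, 3, 5}, {1, 4, 6}, {1, 5, 6},
         {2, 3, 6}, {2, 4, 5}, {2, 5, 6}, {3, 4, 5}, {3, 4, 6}}

/-- `Σ₁`: the 6-vertex 2-sphere with a vertex of degree 3 and one of degree 5. -/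
def Sigma1 : Finset (Finset ℕ) :=
  genBy {{1, 2, 5}, {1, 2, 6}, {1, 5, 6}, {2, 3, 5},
         {2, 3, 6}, {3, 4, 5}, {3, 4, 6}, {4, 5, 6}}

/-- The double pyramid `S¹₅ * S⁰₂`. -/
def S15S02 : Finset (Finset ℕ) :=
  sjoin (genBy {{1, 2}, {2, 3}, {3, 4}, {4, 5}, {1, 5}}) (stdSphere {6, 7})

/-- `Σ₂` (7-vertex 2-sphere with 10 triangles). -/
def Sigma2 : Finset (Finset ℕ) :=
  genBy {{1, 2, 6}, {1, 2, 7}, {1, 6, 7}, {2, 3, 6}, {2, 3, 7},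
         {3, 4, 6}, {3, 4, 7}, {4, 5, 6}, {4, 5, 7}, {5, 6, 7}}

/-- `Σ₃` (7-vertex 2-sphere with 10 triangles). -/
def Sigma3 : Finset (Finset ℕ) :=
  genBy {{1, 2, 6}, {1, 2, 7}, {1, 6, 7}, {2, 3, 4}, {2, 3, 7},
         {2, 4, 6}, {3, 4, 7}, {4, 5, 6}, {4, 5, 7}, {5, 6, 7}}

/-- `Σ₄` (7-vertex 2-sphere with 10 triangles). -/
def Sigma4 : Finset (Finset ℕ) :=
  genBy {{1, 2, 4}, {1, 2, 7}, {1, 4, 5}, {1, 5, 6}, {1, 6, 7},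
         {2, 3, 4}, {2, 3, 7}, {3, 4, 7}, {4, 5, 7}, {5, 6, 7}}

/-- `Σ₅` (7-vertex 2-sphere with 10 triangles). -/
def Sigma5 : Finset (Finset ℕ) :=
  genBy {{1, 2, 3}, {1, 2, 6}, {1, 3, 5}, {1, 5, 6}, {2, 3, 4},
         {2, 4, 6}, {3, 4, 5}, {4, 5, 7}, {4, 6, 7}, {5, 6, 7}}

/-- `Υ₁ = S²₄ ∪ S²₄`: two tetrahedral spheres sharing exactly one vertex. -/
def Upsilon1 : Finset (Finset ℕ) :=
  stdSphere {1, 2, 3, 7} ∪ stdSphere {4, 5, 6, 7}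

/-- `Υ₂ = S²₄ ∪ (S⁰₂ * S¹₃)`: a tetrahedral sphere and a join, where the two
common vertices span an edge of the `S²₄`. -/
def Upsilon2 : Finset (Finset ℕ) :=
  stdSphere {4, 5, 6, 7} ∪ sjoin (stdSphere {6, 7}) (stdSphere {1, 2, 3})

/-- The complex `R` obtained from `ℝP²₆` by the generalized bistellar 1-move
`κ_A`, `A = {1, 2, 5, 6}` (all such choices of `A` yield isomorphic complexes). -/
def Rcomplex : Finset (Finset ℕ) :=
  genBy {{1, 2, 3}, {1, 2, 4}, {1, 2, 5}, {1, 2, 6}, {1, 3, 5},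
         {1, 4, 6}, {2, 3, 6}, {2, 4, 5}, {3, 4, 5}, {3, 4, 6}}


end HomologySpheres

end

/-! ### A kernel-friendly exhaustive search -/

namespace CollapseSearch

noncomputable section

/-- Evaluate `n` before passing it on. -/
def force (n : ℕ) (k : ℕ → Bool) : Bool :=
  Nat.rec (motive := fun _ => Bool) (k 0) (fun p _ => k (Nat.succ p)) n

/-- Zero test. -/
def nif (n : ℕ) (a b : Bool) : Bool :=
  Nat.rec (motive := fun _ => Bool) a (fun _ _ => b) n

/-- Conjunction. -/
def band (x a : Bool) : Bool := Bool.rec (motive := fun _ => Bool) false a x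

/-- The `s`-th block of 64 bits of `M`. -/
def slot (M s : ℕ) : ℕ := Nat.mod (Nat.shiftRight M (Nat.mul 64 s)) 18446744073709551616

/-- The index of the lowest bit of `d`. -/
def pick (d : ℕ) : ℕ := Nat.log2 (Nat.xor d (Nat.sub d 1))

/-- Add the face `p` to the family and continue. -/
def child (rec : ℕ → ℕ → ℕ → ℕ → ℕ → ℕ → ℕ → Bool) (T R I O g1 g2 M m U p : ℕ) : Bool :=
  force (Nat.lor I (Nat.pow 2 p)) fun I' =>
  force (slot T p) fun q =>
  force (Nat.lor g1 q) fun g1' =>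
  force (Nat.lor g2 (Nat.land g1 q)) fun g2' =>
  force (slot M p) fun r =>
  rec I' O g1' g2' (Nat.xor M (Nat.mul (Nat.land (Nat.shiftRight M (Nat.log2 r)) R) r)) m U

/-- Run through the candidate faces in `c`. -/
def loop (T R : ℕ) (rec : ℕ → ℕ → ℕ → ℕ → ℕ → ℕ → ℕ → Bool) (I g1 g2 M m U : ℕ)
    (new : ℕ → Bool) (j : ℕ) : ℕ → ℕ → Bool :=
  Nat.rec (motive := fun _ => ℕ → ℕ → Bool)
    (fun _ _ => false)
    (fun _ ih c O =>
      nif c (new O)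
      (force (pick c) fun p =>
       force (Nat.xor c (Nat.pow 2 p)) fun c' =>
          (nif (slot M p) (ih c' O)
            (band (child rec T R I O g1 g2 M m U p)
              (force (Nat.lor O (Nat.pow 2 p)) fun O' => ih c' O')))))
    j

/-- The search: `I` is the set of faces in the family, `O` a set of faces not in it, `M` the
table of reduced boundaries, `m` the number of vertices used, `U` the faces on these. -/
def go (T R C UT nr : ℕ) (fuel : ℕ) : ℕ → ℕ → ℕ → ℕ → ℕ → ℕ → ℕ → Bool :=
  Nat.rec (motive := fun _ => ℕ → ℕ → ℕ → ℕ → ℕ → ℕ → ℕ → Bool)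
    (fun _ _ _ _ _ _ _ => false)
    (fun _ ih I O g1 g2 M m U =>
      force (pick (Nat.xor g1 g2)) fun e =>
      nif (Nat.sub nr e) false
       (force (slot C e) fun w =>
        force (Nat.land w I) fun a =>
        nif (Nat.xor a (Nat.pow 2 (Nat.log2 a)))
          (force (Nat.land w U) fun w1 =>
           loop T R ih I g1 g2 M m U (fun O => nif (Nat.sub 7 m) true
             (child ih T R I O g1 g2 M (Nat.succ m) (slot UT (Nat.succ m))
               (pick (Nat.xor w w1)))) 8
             (Nat.xor w1 (Nat.land w1 (Nat.lor I O))) O)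
          false)) fuel

theorem force_eq (n : ℕ) (k : ℕ → Bool) : force n k = k n := by
  cases n <;> rfl

theorem nif_eq (n : ℕ) (a b : Bool) : nif n a b = if n = 0 then a else b := by
  cases n <;> rfl

theorem band_eq (a b : Bool) : band a b = (a && b) := by
  cases a <;> rfl

theorem child_eq (rec T R I O g1 g2 M m U p) : child rec T R I O g1 g2 M m U p =
    rec (I ||| 2 ^ p) O (g1 ||| slot T p) (g2 ||| (g1 &&& slot T p))
      (M ^^^ (((M >>> (slot M p).log2) &&& R) * slot M p)) m U := by
  simp only [child, force_eq]; rfl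

theorem loop_succ (T R rec I g1 g2 M m U new j c O) :
    loop T R rec I g1 g2 M m U new (j + 1) c O =
    if c = 0 then new O else
      if slot M (pick c) = 0 then
        loop T R rec I g1 g2 M m U new j (c ^^^ 2 ^ pick c) O
      else
        (child rec T R I O g1 g2 M m U (pick c) &&
          loop T R rec I g1 g2 M m U new j (c ^^^ 2 ^ pick c) (O ||| 2 ^ pick c)) := by
  have : loop T R rec I g1 g2 M m U new (j + 1) c O = nif c (new O)
      (force (pick c) fun p =>
       force (Nat.xor c (Nat.pow 2 p)) fun c' =>
          (nif (slot M p) (loop T R rec I g1 g2 M m U new j c' O)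
            (band (child rec T R I O g1 g2 M m U p)
              (force (Nat.lor O (Nat.pow 2 p)) fun O' =>
                loop T R rec I g1 g2 M m U new j c' O')))) := rfl
  rw [this]
  simp only [force_eq, nif_eq, band_eq]
  rfl

theorem go_succ (T R C UT nr j I O g1 g2 M m U) :
    go T R C UT nr (j + 1) I O g1 g2 M m U =
    (let e := pick (g1 ^^^ g2)
     let w := slot C e
     let a := w &&& I
     if nr - e = 0 then false else
     if a ^^^ (2 ^ a.log2) = 0 then
       loop T R (go T R C UT nr j) I g1 g2 M m U (fun O => if 7 - m = 0 then true else
             (child (go T R C UT nr j) T R I O g1 g2 M (m + 1) (slot UT (m + 1))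
               (pick (w ^^^ (w &&& U))))) 8
             ((w &&& U) ^^^ ((w &&& U) &&& (I ||| O))) O
     else false) := by
  have : go T R C UT nr (j + 1) I O g1 g2 M m U =
    (force (pick (Nat.xor g1 g2)) fun e =>
      nif (Nat.sub nr e) false
       (force (slot C e) fun w =>
        force (Nat.land w I) fun a =>
        nif (Nat.xor a (Nat.pow 2 (Nat.log2 a)))
          (force (Nat.land w U) fun w1 =>
           loop T R (go T R C UT nr j) I g1 g2 M m U (fun O => nif (Nat.sub 7 m) true
             (child (go T R C UT nr j) T R I O g1 g2 M (Nat.succ m) (slot UT (Nat.succ m))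
               (pick (Nat.xor w w1)))) 8
             (Nat.xor w1 (Nat.land w1 (Nat.lor I O))) O)
          false)) := rfl
  rw [this]
  simp only [force_eq, nif_eq]
  rfl

theorem testBit_slot (M s j : ℕ) :
    (slot M s).testBit j = (decide (j < 64) && M.testBit (64 * s + j)) := by
  have : slot M s = (M >>> (64 * s)) % 2 ^ 64 := rfl
  rw [this, Nat.testBit_mod_two_pow, Nat.testBit_shiftRight]

theorem slot_xor (M N s : ℕ) : slot (M ^^^ N) s = slot M s ^^^ slot N s := by
  apply Nat.eq_of_testBit_eq
  intro j
  simp only [testBit_slot, Nat.testBit_xor]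
  cases decide (j < 64) <;> simp

theorem slot_lt (M s : ℕ) : slot M s < 2 ^ 64 := Nat.mod_lt _ (by norm_num)

/-- Multiplying a 0/1 block vector by a block. -/
theorem slot_mul (r : ℕ) (hr : r < 2 ^ 64) (s : ℕ) : ∀ P : ℕ,
    (∀ j, P.testBit j = true → j % 64 = 0) →
    slot (P * r) s = if P.testBit (64 * s) then r else 0 := by
  have slot_eq : ∀ M s, slot M s = (M / 2 ^ (64 * s)) % 2 ^ 64 := by
    intro M s
    rw [← Nat.shiftRight_eq_div_pow]; rfl
  induction s with
  | zero =>
    intro P hP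
    have hm : P % 2 ^ 64 = if P.testBit 0 then 1 else 0 := by
      apply Nat.eq_of_testBit_eq
      intro j
      rw [Nat.testBit_mod_two_pow]
      rcases Nat.eq_zero_or_pos j with rfl | hj
      · cases h : P.testBit 0 <;> simp
      · have h1 : (decide (j < 64) && P.testBit j) = false := by
          by_contra hc
          simp only [Bool.not_eq_false, Bool.and_eq_true, decide_eq_true_eq] at hc
          have := hP j hc.2
          omega
        rw [h1]
        split
        · rw [show (1 : ℕ) = 2 ^ 0 from rfl, Nat.testBit_two_pow]; symm; simp; omega
        · simp
    rw [slot_eq]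
    simp only [Nat.mul_zero, pow_zero, Nat.div_one]
    rw [Nat.mul_mod, hm]
    split
    · rw [Nat.one_mul, Nat.mod_mod, Nat.mod_eq_of_lt hr]
    · simp
  | succ s ih =>
    intro P hP
    have h := ih (P / 2 ^ 64) (by
      intro j hj
      rw [Nat.testBit_div_two_pow] at hj
      have := hP _ hj
      omega)
    have hm : P % 2 ^ 64 ≤ 1 := by
      have : P % 2 ^ 64 < 2 ^ 1 := by
        apply Nat.lt_pow_two_of_testBit
        intro j hj
        rw [Nat.testBit_mod_two_pow]
        by_contra hc
        simp only [Bool.not_eq_false, Bool.and_eq_true, decide_eq_true_eq] at hc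
        have := hP j hc.2
        omega
      omega
    rw [Nat.testBit_div_two_pow] at h
    have e1 : 64 * (s + 1) = 64 * s + 64 := by ring
    rw [e1, ← h, slot_eq, slot_eq]
    congr 1
    rw [e1, Nat.add_comm (64 * s) 64, pow_add, ← Nat.div_div_eq_div_mul]
    congr 1
    conv_lhs => rw [← Nat.div_add_mod P (2 ^ 64)]
    rw [Nat.add_mul, Nat.mul_assoc, Nat.mul_add_div (by norm_num)]
    have : P % 2 ^ 64 * r / 2 ^ 64 = 0 := by
      apply Nat.div_eq_of_lt
      nlinarith
    omega

theorem testBit_pick : ∀ c : ℕ, c ≠ 0 → c.testBit (pick c) = true := by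
  intro c
  induction c using Nat.strong_induction_on with
  | _ c ih =>
  intro hc
  have hp : ∀ c, pick c = (c ^^^ (c - 1)).log2 := fun _ => rfl
  rcases Nat.even_or_odd' c with ⟨d, rfl | rfl⟩
  · have hd : d ≠ 0 := by omega
    have h := ih d (by omega) hd
    have hx : (2 * d) ^^^ (2 * d - 1) = 2 * (d ^^^ (d - 1)) + 1 := by
      apply Nat.eq_of_testBit_eq
      intro j
      have e1 : 2 * d - 1 = 2 * (d - 1) + 1 := by omega
      rw [e1]
      cases j with
      | zero => simp
      | succ j =>
        rw [Nat.testBit_xor]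
        simp only [Nat.testBit_succ]
        rw [show 2 * d / 2 = d by omega, show (2 * (d - 1) + 1) / 2 = d - 1 by omega,
          show (2 * (d ^^^ (d - 1)) + 1) / 2 = d ^^^ (d - 1) by omega, Nat.testBit_xor]
    have hne : d ^^^ (d - 1) ≠ 0 := by
      intro h0
      have := Nat.xor_eq_zero_iff.1 h0
      omega
    have hpk : pick (2 * d) = pick d + 1 := by
      rw [hp, hp, hx, Nat.log2_eq_log_two, Nat.log2_eq_log_two,
        Nat.log_of_one_lt_of_le (by norm_num) (by omega)]
      congr 2
      omega
    rw [hpk, Nat.testBit_succ, show 2 * d / 2 = d by omega]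
    exact h
  · have hx : (2 * d + 1) ^^^ (2 * d + 1 - 1) = 1 := by
      apply Nat.eq_of_testBit_eq
      intro j
      cases j with
      | zero => simp
      | succ j =>
        rw [Nat.testBit_xor]
        simp only [Nat.testBit_succ]
        rw [show (2 * d + 1) / 2 = d by omega, show (2 * d + 1 - 1) / 2 = d by omega]
        simp
    rw [hp, hx, show Nat.log2 1 = 0 by decide]
    simp

/-- The mod 2 boundary of a set. -/
def bd (s : Finset ℕ) : Finset ℕ → ZMod 2 := fun t => if ∃ x ∈ s, s.erase x = t then 1 else 0

/-- A family of faces on seven vertices without free ridges and with independent boundaries. -/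
structure Bad (T : Set (Finset ℕ)) : Prop where
  sub : ∀ s ∈ T, s ⊆ Finset.range 7
  ind : LinearIndepOn (ZMod 2) bd T
  fr : ∀ s ∈ T, ∀ x ∈ s, ∃ y, y < 7 ∧ y ∉ s ∧ insert y (s.erase x) ∈ T

theorem bd_image (σ : Equiv.Perm ℕ) (s t : Finset ℕ) :
    bd (s.image σ) (t.image σ) = bd s t := by
  unfold bd
  congr 1
  apply propext
  constructor
  · rintro ⟨x, hx, h⟩
    obtain ⟨z, hz, rfl⟩ := Finset.mem_image.1 hx
    refine ⟨z, hz, ?_⟩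
    rw [← Finset.image_erase σ.injective] at h
    exact Finset.image_injective σ.injective h
  · rintro ⟨x, hx, rfl⟩
    exact ⟨σ x, Finset.mem_image_of_mem _ hx, by rw [Finset.image_erase σ.injective]⟩

/-- Relabelling a family by a permutation. -/
def perm (σ : Equiv.Perm ℕ) (T : Set (Finset ℕ)) : Set (Finset ℕ) := {s | s.image σ ∈ T}

theorem Bad.perm {T : Set (Finset ℕ)} (hT : Bad T) (σ : Equiv.Perm ℕ)
    (hσ : ∀ x, σ x < 7 ↔ x < 7) : Bad (perm σ T) where
  sub := by
    intro s hs x hx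
    have := hT.sub _ hs (Finset.mem_image_of_mem σ hx)
    rw [Finset.mem_range, hσ] at this
    exact Finset.mem_range.2 this
  ind := by
    let L : (Finset ℕ → ZMod 2) →ₗ[ZMod 2] (Finset ℕ → ZMod 2) :=
      LinearMap.funLeft (ZMod 2) (ZMod 2) (fun t : Finset ℕ => t.image σ)
    have hL : LinearMap.ker L = ⊥ := by
      rw [LinearMap.ker_eq_bot]
      apply LinearMap.funLeft_injective_of_surjective
      intro t
      refine ⟨t.image σ.symm, ?_⟩
      simp [Finset.image_image]
    have h1 : LinearIndependent (ZMod 2) (fun s : CollapseSearch.perm σ T => bd (s.1.image σ)) :=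
      LinearIndependent.comp (v := fun s : T => bd s.1) hT.ind
        (fun s : CollapseSearch.perm σ T => (⟨s.1.image σ, s.2⟩ : T)) (by
          intro a b hab
          exact Subtype.ext (Finset.image_injective σ.injective (congrArg Subtype.val hab)))
    have h2 := h1.map' L hL
    have h3 : (L ∘ fun s : CollapseSearch.perm σ T => bd (s.1.image σ)) =
        fun s : CollapseSearch.perm σ T => bd s.1 := by
      funext s t
      exact bd_image σ s.1 t
    rw [h3] at h2
    exact h2
  fr := by
    intro s hs x hx
    obtain ⟨y, hy, hys, hyT⟩ := hT.fr _ hs (σ x) (Finset.mem_image_of_mem σ hx)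
    refine ⟨σ.symm y, ?_, ?_, ?_⟩
    · rw [← hσ]; simpa using hy
    · intro h; apply hys
      rw [Finset.mem_image]
      exact ⟨_, h, by simp⟩
    · show (insert (σ.symm y) (s.erase x)).image σ ∈ T
      rw [Finset.image_insert, Finset.image_erase σ.injective]
      simpa using hyT

/-- The vector encoded by a bit mask of ridge indices. -/
def vec (nr : ℕ) (dR : ℕ → Finset ℕ) (v : ℕ) : Finset ℕ → ZMod 2 := fun t =>
  ∑ j ∈ Finset.range nr, if v.testBit j = true ∧ dR j = t then 1 else 0

theorem vec_xor (nr dR a b) : vec nr dR (a ^^^ b) = vec nr dR a + vec nr dR b := by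
  funext t
  simp only [vec, Pi.add_apply, ← Finset.sum_add_distrib]
  apply Finset.sum_congr rfl
  intro j _
  rw [Nat.testBit_xor]
  by_cases h : dR j = t
  · cases a.testBit j <;> cases b.testBit j <;> simp [h]
    decide
  · simp [h]

theorem vec_zero (nr dR) : vec nr dR 0 = 0 := by
  funext t
  simp [vec]

/-- Correctness of the tables. -/
structure Tab (nf nr T R C UT : ℕ) (dF dR : ℕ → Finset ℕ) : Prop where
  s1 : ∀ e < nr, ∀ x < 7, x ∉ dR e → ∃ p < nf, (slot C e).testBit p = true ∧ dF p = insert x (dR e)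
  s2 : ∀ e < nr, ∀ p, (slot C e).testBit p = true →
    p < nf ∧ ∃ x < 7, x ∉ dR e ∧ dF p = insert x (dR e)
  s3 : ∀ p < nf, ∀ q < nf, dF p = dF q → p = q
  s4 : ∀ p < nf, vec nr dR (slot T p) = bd (dF p)
  s5 : ∀ m ≤ 7, ∀ p < nf, (slot UT m).testBit p = true ↔ dF p ⊆ Finset.range m
  s6 : ∀ m < 7, ∀ e < nr, dR e ⊆ Finset.range m →
    pick (slot C e ^^^ (slot C e &&& slot UT m)) < nf ∧
    dF (pick (slot C e ^^^ (slot C e &&& slot UT m))) = insert m (dR e)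
  s7 : ∀ j, R.testBit j = true → j % 64 = 0

/-- The search state describes part of `S`. -/
structure St (nf nr : ℕ) (dF dR : ℕ → Finset ℕ) (S : Set (Finset ℕ)) (I O M m : ℕ) : Prop where
  hI : ∀ p, I.testBit p = true → p < nf ∧ dF p ∈ S ∧ dF p ⊆ Finset.range m
  hO : ∀ p < nf, O.testBit p = true → dF p ∉ S ∧ dF p ⊆ Finset.range m
  hM : ∀ p < nf, vec nr dR (slot M p) - bd (dF p) ∈
    Submodule.span (ZMod 2) (bd '' {s | ∃ q, I.testBit q = true ∧ s = dF q})
  hm : m ≤ 7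

section
variable {nf nr T R C UT : ℕ} {dF dR : ℕ → Finset ℕ}

theorem child_sound (hT : Tab nf nr T R C UT dF dR) {S : Set (Finset ℕ)}
    {rec : ℕ → ℕ → ℕ → ℕ → ℕ → ℕ → ℕ → Bool} {I O g1 g2 M m p : ℕ}
    (hrec : ∀ I O g1 g2 M m, St nf nr dF dR S I O M m →
      rec I O g1 g2 M m (slot UT m) = true → False)
    (hs : St nf nr dF dR S I O M m) (hp : p < nf) (hpS : dF p ∈ S)
    (hpm : dF p ⊆ Finset.range m) :
    child rec T R I O g1 g2 M m (slot UT m) p = true → False := by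
  rw [child_eq]
  apply hrec
  have hbit : ∀ q, (I ||| 2 ^ p).testBit q = true ↔ I.testBit q = true ∨ p = q := by
    intro q
    rw [Nat.testBit_or, Nat.testBit_two_pow]
    simp
  have hle : Submodule.span (ZMod 2) (bd '' {s | ∃ q, I.testBit q = true ∧ s = dF q}) ≤
      Submodule.span (ZMod 2) (bd '' {s | ∃ q, (I ||| 2 ^ p).testBit q = true ∧ s = dF q}) := by
    apply Submodule.span_mono
    apply Set.image_mono
    rintro s ⟨q, hq, rfl⟩
    exact ⟨q, (hbit q).2 (Or.inl hq), rfl⟩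
  have hr : vec nr dR (slot M p) ∈
      Submodule.span (ZMod 2) (bd '' {s | ∃ q, (I ||| 2 ^ p).testBit q = true ∧ s = dF q}) := by
    have h1 := hle (hs.hM p hp)
    have h2 : bd (dF p) ∈
      Submodule.span (ZMod 2) (bd '' {s | ∃ q, (I ||| 2 ^ p).testBit q = true ∧ s = dF q}) :=
      Submodule.subset_span ⟨_, ⟨p, (hbit p).2 (Or.inr rfl), rfl⟩, rfl⟩
    simpa using add_mem h1 h2
  constructor
  · intro q hq
    rcases (hbit q).1 hq with h | rfl
    · exact hs.hI q h
    · exact ⟨hp, hpS, hpm⟩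
  · exact hs.hO
  · intro q hq
    rw [slot_xor, slot_mul _ (slot_lt _ _) _ _ (by
      intro j hj
      rw [Nat.testBit_and, Bool.and_eq_true] at hj
      exact hT.s7 j hj.2), vec_xor]
    have h1 := hle (hs.hM q hq)
    rw [add_sub_right_comm]
    apply add_mem h1
    split
    · exact hr
    · rw [vec_zero]; exact zero_mem _
  · exact hs.hm

theorem not_mem_of_slot_zero {S : Set (Finset ℕ)} (hS : Bad S) (hT : Tab nf nr T R C UT dF dR)
    {I O M m p : ℕ} (hs : St nf nr dF dR S I O M m) (hp : p < nf) (hpI : I.testBit p = false)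
    (h0 : slot M p = 0) : dF p ∉ S := by
  intro hpS
  have h := hs.hM p hp
  rw [h0, vec_zero, zero_sub] at h
  have h := neg_mem h
  rw [neg_neg] at h
  have hns : dF p ∉ {s | ∃ q, I.testBit q = true ∧ s = dF q} := by
    rintro ⟨q, hq, he⟩
    have := hT.s3 p hp q (hs.hI q hq).1 he
    subst this
    rw [hpI] at hq
    exact absurd hq (by simp)
  refine hns ?_
  have hsub : {s | ∃ q, I.testBit q = true ∧ s = dF q} ⊆ S := by
    rintro s ⟨q, hq, rfl⟩
    exact (hs.hI q hq).2.1
  exact (hS.ind.mono hsub).mem_span_iff.1 h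
    (hS.ind.mono (Set.insert_subset hpS hsub))

theorem loop_sound (hT : Tab nf nr T R C UT dF dR) {S : Set (Finset ℕ)} (hS : Bad S)
    {rec : ℕ → ℕ → ℕ → ℕ → ℕ → ℕ → ℕ → Bool} {I g1 g2 M m : ℕ} {new : ℕ → Bool}
    (hrec : ∀ I O g1 g2 M m, St nf nr dF dR S I O M m →
      rec I O g1 g2 M m (slot UT m) = true → False) : ∀ (j c O : ℕ),
    St nf nr dF dR S I O M m →
    (∀ p, c.testBit p = true → p < nf ∧ dF p ⊆ Finset.range m ∧ I.testBit p = false) →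
    ((∃ p, c.testBit p = true ∧ dF p ∈ S) ∨
      ∀ O, St nf nr dF dR S I O M m → new O = true → False) →
    loop T R rec I g1 g2 M m (slot UT m) new j c O = true → False := by
  intro j
  induction j with
  | zero =>
    intro c O _ _ _ h
    exact absurd h (by simp [loop])
  | succ j ih =>
    intro c O hs hc hex
    rw [loop_succ]
    by_cases h0 : c = 0
    · rw [if_pos h0]
      rcases hex with ⟨p, hp, _⟩ | h
      · rw [h0] at hp; simp at hp
      · exact h O hs
    rw [if_neg h0]
    have hpk := testBit_pick c h0
    generalize pick c = p at hpk
    obtain ⟨hp, hpm, hpI⟩ := hc p hpk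
    have hbit : ∀ q, (c ^^^ 2 ^ p).testBit q = true ↔ c.testBit q = true ∧ p ≠ q := by
      intro q
      rw [Nat.testBit_xor, Nat.testBit_two_pow]
      by_cases hq : p = q
      · subst hq; simp [hpk]
      · simp [hq]
    have hc' : ∀ q, (c ^^^ 2 ^ p).testBit q = true →
        q < nf ∧ dF q ⊆ Finset.range m ∧ I.testBit q = false := by
      intro q hq
      exact hc q ((hbit q).1 hq).1
    have hex' : dF p ∉ S → ((∃ q, (c ^^^ 2 ^ p).testBit q = true ∧ dF q ∈ S) ∨
        ∀ O, St nf nr dF dR S I O M m → new O = true → False) := by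
      intro hpS
      rcases hex with ⟨q, hq, hqS⟩ | h
      · left
        refine ⟨q, (hbit q).2 ⟨hq, ?_⟩, hqS⟩
        rintro rfl
        exact hpS hqS
      · exact Or.inr h
    by_cases hM : slot M p = 0
    · rw [if_pos hM]
      exact ih _ _ hs hc' (hex' (not_mem_of_slot_zero hS hT hs hp hpI hM))
    · rw [if_neg hM, Bool.and_eq_true]
      rintro ⟨h1, h2⟩
      have hpS : dF p ∉ S := fun hpS => child_sound hT hrec hs hp hpS hpm h1
      refine ih _ _ ⟨hs.hI, ?_, hs.hM, hs.hm⟩ hc' (hex' hpS) h2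
      intro q hq hqO
      rw [Nat.testBit_or, Nat.testBit_two_pow] at hqO
      simp only [Bool.or_eq_true, decide_eq_true_eq] at hqO
      rcases hqO with h | rfl
      · exact hs.hO q hq h
      · exact ⟨hpS, hpm⟩

theorem go_sound (hT : Tab nf nr T R C UT dF dR) : ∀ (fuel : ℕ) (S : Set (Finset ℕ)), Bad S →
    ∀ I O g1 g2 M m, St nf nr dF dR S I O M m →
    go T R C UT nr fuel I O g1 g2 M m (slot UT m) = true → False := by
  intro fuel
  induction fuel with
  | zero =>
    intro S _ I O g1 g2 M m _ h
    exact absurd h (by simp [go])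
  | succ j ih =>
    intro S hS I O g1 g2 M m hs
    rw [go_succ]
    generalize pick (g1 ^^^ g2) = e
    dsimp only
    by_cases he : nr - e = 0
    · rw [if_pos he]; simp
    rw [if_neg he]
    by_cases ha : (slot C e &&& I) ^^^ 2 ^ (slot C e &&& I).log2 = 0
    swap
    · rw [if_neg ha]; simp
    rw [if_pos ha]
    replace he : e < nr := by omega
    rw [Nat.xor_eq_zero_iff] at ha
    generalize (slot C e &&& I).log2 = q at ha
    have haq : ∀ p, ((slot C e).testBit p = true ∧ I.testBit p = true) ↔ q = p := by
      intro p
      rw [← Bool.and_eq_true, ← Nat.testBit_and, ha, Nat.testBit_two_pow]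
      simp
    obtain ⟨hqC, hqI⟩ := (haq q).2 rfl
    obtain ⟨hq, x, hx7, hxe, hqx⟩ := hT.s2 e he q hqC
    obtain ⟨-, hqS, hqm⟩ := hs.hI q hqI
    obtain ⟨y, hy7, hyq, hyS⟩ := hS.fr _ hqS x (by rw [hqx]; simp)
    have hem : dR e ⊆ Finset.range m := by
      rw [hqx] at hqm
      exact (Finset.subset_insert _ _).trans hqm
    rw [hqx, Finset.erase_insert hxe] at hyS
    have hye : y ∉ dR e := by
      intro h; apply hyq; rw [hqx]; exact Finset.mem_insert_of_mem h
    refine loop_sound hT hS (ih S hS) _ _ _ hs ?_ ?_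
    · intro p hp
      simp only [Nat.testBit_xor, Nat.testBit_and, Nat.testBit_or] at hp
      have hpC : (slot C e).testBit p = true := by
        cases h : (slot C e).testBit p
        · rw [h] at hp; simp at hp
        · rfl
      have hpU : (slot UT m).testBit p = true := by
        cases h : (slot UT m).testBit p
        · rw [h] at hp; simp at hp
        · rfl
      have hpI : I.testBit p = false := by
        cases h : I.testBit p
        · rfl
        · rw [h, hpC, hpU] at hp; simp at hp
      have hpn := (hT.s2 e he p hpC).1
      exact ⟨hpn, (hT.s5 m hs.hm p hpn).1 hpU, hpI⟩
    · by_cases hym : y < m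
      · left
        obtain ⟨p, hp, hpC, hpe⟩ := hT.s1 e he y hy7 hye
        have hpS : dF p ∈ S := by rw [hpe]; exact hyS
        refine ⟨p, ?_, hpS⟩
        have hpU : (slot UT m).testBit p = true := by
          rw [hT.s5 m hs.hm p hp, hpe]
          intro z hz
          rcases Finset.mem_insert.1 hz with rfl | hz
          · exact Finset.mem_range.2 hym
          · exact hem hz
        have hpI : I.testBit p = false := by
          cases h : I.testBit p
          · rfl
          · have := (haq p).1 ⟨hpC, h⟩
            subst this
            exfalso; apply hyq; rw [hpe]; simp
        have hpO : O.testBit p = false := by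
          cases h : O.testBit p
          · rfl
          · exact absurd hpS (hs.hO p hp h).1
        simp [Nat.testBit_xor, Nat.testBit_and, Nat.testBit_or, hpC, hpU, hpI, hpO]
      · right
        intro O hs
        have hm7 : m < 7 := by omega
        rw [if_neg (by omega)]
        let σ : Equiv.Perm ℕ := Equiv.swap m y
        have hfix : ∀ s : Finset ℕ, s ⊆ Finset.range m → s.image σ = s := by
          intro s hsm
          rw [Finset.image_congr (g := id), Finset.image_id]
          intro z hz
          have := Finset.mem_range.1 (hsm hz)
          exact Equiv.swap_apply_of_ne_of_ne (by omega) (by omega)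
        have hS' : Bad (perm σ S) := by
          apply hS.perm
          intro z
          show Equiv.swap m y z < 7 ↔ z < 7
          rw [Equiv.swap_apply_def]
          split_ifs <;> omega
        have hiff : ∀ s : Finset ℕ, s ⊆ Finset.range m → (s ∈ perm σ S ↔ s ∈ S) := by
          intro s hsm
          show s.image σ ∈ S ↔ s ∈ S
          rw [hfix s hsm]
        have hmm : Finset.range m ⊆ Finset.range (m + 1) :=
          Finset.range_subset_range.2 (by omega)
        obtain ⟨hpn, hpe⟩ := hT.s6 m hm7 e he hem
        refine child_sound hT (ih _ hS') (S := perm σ S) ⟨?_, ?_, hs.hM, hm7⟩ hpn ?_ ?_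
        · intro p hp
          obtain ⟨a, b, c⟩ := hs.hI p hp
          exact ⟨a, (hiff _ c).2 b, c.trans hmm⟩
        · intro p hp hpO
          obtain ⟨b, c⟩ := hs.hO p hp hpO
          exact ⟨fun h => b ((hiff _ c).1 h), c.trans hmm⟩
        · rw [hpe]
          show (insert m (dR e)).image σ ∈ S
          rw [Finset.image_insert, hfix _ hem]
          simpa [σ] using hyS
        · rw [hpe]
          intro z hz
          rcases Finset.mem_insert.1 hz with rfl | hz
          · simp
          · exact hmm (hem hz)

theorem start_sound (hT : Tab nf nr T R C UT dF dR) {S : Set (Finset ℕ)} (hS : Bad S)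
    {k : ℕ} (hk : k ≤ 7) (hnf : 0 < nf) (h0 : dF 0 = Finset.range k) (hkS : Finset.range k ∈ S)
    {fuel : ℕ} :
    child (go T R C UT nr fuel) T R 0 0 0 0 T k (slot UT k) 0 = true → False := by
  refine child_sound hT (go_sound hT fuel S hS) (S := S) ⟨?_, ?_, ?_, hk⟩ hnf ?_ ?_
  · intro p hp; simp at hp
  · intro p _ hp; simp at hp
  · intro p hp
    rw [hT.s4 p hp, sub_self]
    exact zero_mem _
  · rw [h0]; exact hkS
  · rw [h0]

end

/-- The subset of `{0, ..., 6}` encoded by a bit mask. -/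
def dec (s : ℕ) : Finset ℕ := (Finset.range 7).filter fun x => s.testBit x = true

theorem mem_dec {s x : ℕ} : x ∈ dec s ↔ x < 7 ∧ s.testBit x = true := by
  simp [dec]

theorem dec_or {s x : ℕ} (hx : x < 7) : dec (s ||| 2 ^ x) = insert x (dec s) := by
  ext y
  simp only [mem_dec, Finset.mem_insert, Nat.testBit_or, Nat.testBit_two_pow, Bool.or_eq_true,
    decide_eq_true_eq]
  constructor
  · rintro ⟨h, h1 | rfl⟩
    · exact Or.inr ⟨h, h1⟩
    · exact Or.inl rfl
  · rintro (rfl | ⟨h, h1⟩)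
    · exact ⟨hx, Or.inr rfl⟩
    · exact ⟨h, Or.inl h1⟩

theorem dec_xor {s x : ℕ} (hs : s.testBit x = true) : dec (s ^^^ 2 ^ x) = (dec s).erase x := by
  ext y
  simp only [mem_dec, Finset.mem_erase, Nat.testBit_xor, Nat.testBit_two_pow]
  by_cases h : x = y
  · subst h; simp [hs]
  · simp [h, Ne.symm h]

theorem dec_inj {s t : ℕ} (hs : s < 128) (ht : t < 128) (h : dec s = dec t) : s = t := by
  apply Nat.eq_of_testBit_eq
  intro j
  by_cases hj : j < 7
  · have := Finset.ext_iff.1 h j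
    simp only [mem_dec, hj, true_and] at this
    exact Bool.eq_iff_iff.2 this
  · have h2 : 2 ^ 7 ≤ 2 ^ j := Nat.pow_le_pow_right (by norm_num) (by omega)
    rw [Nat.testBit_lt_two_pow (by omega), Nat.testBit_lt_two_pow (by omega)]

theorem dec_subset {s m : ℕ} (hs : s < 128) : dec s ⊆ Finset.range m ↔ s < 2 ^ m := by
  constructor
  · intro h
    apply Nat.lt_pow_two_of_testBit
    intro j hj
    by_contra hc
    rw [Bool.not_eq_false] at hc
    by_cases hj7 : j < 7
    · have := Finset.mem_range.1 (h (mem_dec.2 ⟨hj7, hc⟩))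
      omega
    · have h2 : 2 ^ 7 ≤ 2 ^ j := Nat.pow_le_pow_right (by norm_num) (by omega)
      rw [Nat.testBit_lt_two_pow (by omega)] at hc
      exact absurd hc (by simp)
  · intro h x hx
    rw [Finset.mem_range]
    by_contra hc
    have h2 : 2 ^ m ≤ 2 ^ x := Nat.pow_le_pow_right (by norm_num) (by omega)
    have := (mem_dec.1 hx).2
    rw [Nat.testBit_lt_two_pow (by omega)] at this
    exact absurd this (by simp)

/-- Correctness of the tables at the level of masks. -/
def TabOK (nf nr T C UT FT RT : ℕ) : Prop :=
  (∀ e < nr, ∀ x < 7, (slot RT e).testBit x = false →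
    ∃ p, p < nf ∧ (slot C e).testBit p = true ∧ slot FT p = slot RT e ||| 2 ^ x) ∧
  (∀ e < nr, ∀ p < 64, (slot C e).testBit p = true → p < nf ∧
    ∃ x, x < 7 ∧ (slot RT e).testBit x = false ∧ slot FT p = slot RT e ||| 2 ^ x) ∧
  (∀ p < nf, slot FT p < 128) ∧ (∀ e < nr, slot RT e < 128) ∧
  (∀ p < nf, ∀ q < nf, slot FT p = slot FT q → p = q) ∧
  (∀ p < nr, ∀ q < nr, slot RT p = slot RT q → p = q) ∧
  (∀ p < nf, ∀ j < nr, (slot T p).testBit j = true →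
    ∃ x, x < 7 ∧ (slot FT p).testBit x = true ∧ slot RT j = slot FT p ^^^ 2 ^ x) ∧
  (∀ p < nf, ∀ x < 7, (slot FT p).testBit x = true →
    ∃ j, j < nr ∧ (slot T p).testBit j = true ∧ slot RT j = slot FT p ^^^ 2 ^ x) ∧
  (∀ m < 8, ∀ p < nf, (slot UT m).testBit p = true ↔ slot FT p < 2 ^ m) ∧
  (∀ m < 7, ∀ e < nr, slot RT e < 2 ^ m →
    pick (slot C e ^^^ (slot C e &&& slot UT m)) < nf ∧
    slot FT (pick (slot C e ^^^ (slot C e &&& slot UT m))) = slot RT e ||| 2 ^ m)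

set_option synthInstance.maxSize 10000 in
set_option synthInstance.maxHeartbeats 400000 in
instance (nf nr T C UT FT RT : ℕ) : Decidable (TabOK nf nr T C UT FT RT) := by
  unfold TabOK
  infer_instance

theorem not_testBit_of {s x : ℕ} (hx : x < 7) (h : x ∉ dec s) : s.testBit x = false := by
  rw [mem_dec, not_and, Bool.not_eq_true] at h
  exact h hx

theorem TabOK.tab {nf nr T C UT FT RT R : ℕ} (h : TabOK nf nr T C UT FT RT)
    (hR : ∀ j, R.testBit j = true → j % 64 = 0) :
    Tab nf nr T R C UT (fun p => dec (slot FT p)) (fun e => dec (slot RT e)) := by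
  obtain ⟨c1, c2, cF, cR, iF, iR, t1, t2, cU, cP⟩ := h
  constructor
  · intro e he x hx hxe
    obtain ⟨p, hp, hpC, h⟩ := c1 e he x hx (not_testBit_of hx hxe)
    exact ⟨p, hp, hpC, by rw [h, dec_or hx]⟩
  · intro e he p hp
    have hp64 : p < 64 := by
      rw [testBit_slot, Bool.and_eq_true, decide_eq_true_eq] at hp
      exact hp.1
    obtain ⟨h1, x, hx, hxe, h⟩ := c2 e he p hp64 hp
    refine ⟨h1, x, hx, ?_, ?_⟩
    · rw [mem_dec, hxe]; simp
    · show dec (slot FT p) = _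
      rw [h, dec_or hx]
  · intro p hp q hq h
    exact iF p hp q hq (dec_inj (cF p hp) (cF q hq) h)
  · intro p hp
    funext t
    unfold vec bd
    by_cases ht : ∃ x ∈ dec (slot FT p), (dec (slot FT p)).erase x = t
    · rw [if_pos ht]
      obtain ⟨x, hx, rfl⟩ := ht
      obtain ⟨hx7, hxb⟩ := mem_dec.1 hx
      obtain ⟨j, hj, hjT, hje⟩ := t2 p hp x hx7 hxb
      have hdec : dec (slot RT j) = (dec (slot FT p)).erase x := by rw [hje, dec_xor hxb]
      rw [Finset.sum_eq_single j, if_pos ⟨hjT, hdec⟩]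
      · intro i hi hij
        rw [if_neg]
        rintro ⟨-, h⟩
        rw [← hdec] at h
        have hi := Finset.mem_range.1 hi
        exact hij (iR i hi j hj (dec_inj (cR i hi) (cR j hj) h))
      · intro h; exact absurd (Finset.mem_range.2 hj) h
    · rw [if_neg ht]
      apply Finset.sum_eq_zero
      intro j hj
      rw [if_neg]
      rintro ⟨hb, rfl⟩
      obtain ⟨x, hx, hxF, h⟩ := t1 p hp j (Finset.mem_range.1 hj) hb
      refine ht ⟨x, mem_dec.2 ⟨hx, hxF⟩, ?_⟩
      show _ = dec (slot RT j)
      rw [h, dec_xor hxF]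
  · intro m hm p hp
    rw [cU m (by omega) p hp, dec_subset (cF p hp)]
  · intro m hm e he h
    obtain ⟨h1, h2⟩ := cP m hm e he ((dec_subset (cR e he)).1 h)
    refine ⟨h1, ?_⟩
    show dec (slot FT _) = _
    rw [h2, dec_or hm]
  · exact hR

theorem unit_blocks (n : ℕ) : ∀ j, (∑ i ∈ Finset.range n, 2 ^ (64 * i)).testBit j = true →
    j % 64 = 0 := by
  induction n with
  | zero => intro j hj; simp at hj
  | succ n ih =>
    intro j hj
    rw [Finset.sum_range_succ', ← Nat.add_comm, Nat.mul_zero] at hj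
    have : ∑ i ∈ Finset.range n, 2 ^ (64 * (i + 1)) =
        2 ^ 64 * ∑ i ∈ Finset.range n, 2 ^ (64 * i) := by
      rw [Finset.mul_sum]
      apply Finset.sum_congr rfl
      intro i _
      rw [← pow_add]; congr 1; ring
    rw [this, Nat.add_comm, Nat.testBit_two_pow_mul_add _ (by norm_num)] at hj
    split at hj
    · rw [pow_zero, show (1 : ℕ) = 2 ^ 0 from rfl, Nat.testBit_two_pow] at hj
      simp at hj
      omega
    · have := ih _ hj
      omega


theorem tabOK2 : TabOK 21 7
    1998322981375564623819920564426200147618987852229772753147632918253930301652045508518262623383301077905729828318073667317962329380228627830679101547273761226033059796540125533061895838465806249769130425652544943219316095321710205277932195050673267973587827357984493937703739700239962248529785709596045483226013849164970768628784980452440089859332127588953151795732634105915761263529426947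
    81340871159737620576469003432740951621661439024607417240174723572343488056231760214958641766290429496976845674694207112267
    1524290557495256286123696058573173855124624265628468910321952797920659238400002780327059946311535240306187538606986146807582662826831351119872
    1998322981375564623819920564426200147618987852229772753147632918253930301652045508518262623383301077905729828318073667317962329380228627830679101547273761226033059796540125533061895838465806249769130425652544943219316095321710205277932195050673267973587827357984493937703739700239962248529785709596045483226013849164970768628784980452440089859332127588953151795732634105915761263529426947
    2521728396569246669654210151558660406163596681335011313542804675161161181985891177780327665647429129191959175003897857 := by
  decide +kernel

theorem search2 : child (go
      1998322981375564623819920564426200147618987852229772753147632918253930301652045508518262623383301077905729828318073667317962329380228627830679101547273761226033059796540125533061895838465806249769130425652544943219316095321710205277932195050673267973587827357984493937703739700239962248529785709596045483226013849164970768628784980452440089859332127588953151795732634105915761263529426947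
      20815864389328798164978910924381867629797360486714762199165467201162334166037832870841687597205545420151422479276557647141784261178796259276090401114623550805273696779219680586165963622862524532556987526715631478952092709180121520193228225991267132644176201079196477282366298977860091200522286961229449695544360983818200623447904666682692540170885209816137411551283894036199041316945921
      81340871159737620576469003432740951621661439024607417240174723572343488056231760214958641766290429496976845674694207112267
      1524290557495256286123696058573173855124624265628468910321952797920659238400002780327059946311535240306187538606986146807582662826831351119872
      7 25)
    1998322981375564623819920564426200147618987852229772753147632918253930301652045508518262623383301077905729828318073667317962329380228627830679101547273761226033059796540125533061895838465806249769130425652544943219316095321710205277932195050673267973587827357984493937703739700239962248529785709596045483226013849164970768628784980452440089859332127588953151795732634105915761263529426947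
    20815864389328798164978910924381867629797360486714762199165467201162334166037832870841687597205545420151422479276557647141784261178796259276090401114623550805273696779219680586165963622862524532556987526715631478952092709180121520193228225991267132644176201079196477282366298977860091200522286961229449695544360983818200623447904666682692540170885209816137411551283894036199041316945921
    0 0 0 0
    1998322981375564623819920564426200147618987852229772753147632918253930301652045508518262623383301077905729828318073667317962329380228627830679101547273761226033059796540125533061895838465806249769130425652544943219316095321710205277932195050673267973587827357984493937703739700239962248529785709596045483226013849164970768628784980452440089859332127588953151795732634105915761263529426947
    2 (slot
      1524290557495256286123696058573173855124624265628468910321952797920659238400002780327059946311535240306187538606986146807582662826831351119872 2) 0 = true := by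
  decide +kernel

theorem no_bad2 {S : Set (Finset ℕ)} (hS : Bad S) (h : Finset.range 2 ∈ S) : False :=
  start_sound (tabOK2.tab (by
    have h := unit_blocks 21
    rwa [show ∑ i ∈ Finset.range 21, 2 ^ (64 * i) =
      20815864389328798164978910924381867629797360486714762199165467201162334166037832870841687597205545420151422479276557647141784261178796259276090401114623550805273696779219680586165963622862524532556987526715631478952092709180121520193228225991267132644176201079196477282366298977860091200522286961229449695544360983818200623447904666682692540170885209816137411551283894036199041316945921
      by decide +kernel] at h)) hS
    (by norm_num) (by norm_num) (by decide +kernel) h search2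

theorem tabOK3 : TabOK 35 21
    17476812960910093116415553643038607475769422727538859698435345883453595921578515805074020101409391630199199827104863132372118377711217373100260828349392151649129991967532721802939827729739454261019365779391902838755689973495269266231357614844445969701082027837911901140448440856377157213906402498899827324358954326675686172053386858258780598238610644118262689860090681138802232529558282274233370724947176175349051123174185959021034773974476488572678987565805101192877296775047140165411066765168655166887186551078692852493973665583229772769379376376341757299489578793775132912349049392081623838483560532515906045445376762020520022728696285677638085689726193369095
    692876790123571046182122844324432210226367556216331524879024563414319161496721257062549723828612386399177366183249287253324184918076426674473034082118635094326305408168254785985252519337821214442419916621302557030841070182153624226674495896941713680064590971066633306609376114899707921206158898506673029300336073528127570926796289993457685355434940349112308698881308537472693922836420008652833811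
    24973988401801099126757212263754654022441820624645715592022874292500933326433237072900733826387172755206855197486267273108338935099769992706523136
    1231653619587333398594185717596200970443890104257606898570904479143441852525733347459978048922778730669180704426374793238830541153675636866012488276973321669098734771799888741559233432555297871399965105561191093609205144306388207979069145987138100145892735071469915237623868703724820337724370760130402536352296680432312357039118160653521203743344631051201037567782656247403307078398897416543661373675387647052574969873665100557438119760502539805221660905722143336094636013707656002693382586058332508749350675839027520995810600779651380467981145053989100257493530050044644969074882198648848898016284553597580917150619805420096568666994161550826086419071500295
    1998322981375564623819920564426200147618987852229772753147632918253930301652045508518262623383301077905729828318073667317962329380228627830679101547273761226033059796540125533061895838465806249769130425652544943219316095321710205277932195050673267973587827357984493937703739700239962248529785709596045483226013849164970768628784980452440089859332127588953151795732634105915761263529426947 := by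
  decide +kernel

theorem search3 : child (go
      17476812960910093116415553643038607475769422727538859698435345883453595921578515805074020101409391630199199827104863132372118377711217373100260828349392151649129991967532721802939827729739454261019365779391902838755689973495269266231357614844445969701082027837911901140448440856377157213906402498899827324358954326675686172053386858258780598238610644118262689860090681138802232529558282274233370724947176175349051123174185959021034773974476488572678987565805101192877296775047140165411066765168655166887186551078692852493973665583229772769379376376341757299489578793775132912349049392081623838483560532515906045445376762020520022728696285677638085689726193369095
      10996907317744048201776382731410793802048645782714020512400457251596748538331474405450875867149761726668807828593098798500685399567041520875592067515910773144625994887707680655329453268887872566001049869710293550134396784388225273277393810974100352408645952997664904916665018199936076462352756316346531115833231102795548960297158953861983644576309807910385838015839817432914994830149465297667558118278755329800282526199791924049110177155763289310922145780207305530304719991902601452389002394240556070482319093715590199305710659362089203858894818256128697135336704349783707641415972881552705137805446667009282041271297772176773668639458687112781151112003585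
      692876790123571046182122844324432210226367556216331524879024563414319161496721257062549723828612386399177366183249287253324184918076426674473034082118635094326305408168254785985252519337821214442419916621302557030841070182153624226674495896941713680064590971066633306609376114899707921206158898506673029300336073528127570926796289993457685355434940349112308698881308537472693922836420008652833811
      24973988401801099126757212263754654022441820624645715592022874292500933326433237072900733826387172755206855197486267273108338935099769992706523136
      21 25)
    17476812960910093116415553643038607475769422727538859698435345883453595921578515805074020101409391630199199827104863132372118377711217373100260828349392151649129991967532721802939827729739454261019365779391902838755689973495269266231357614844445969701082027837911901140448440856377157213906402498899827324358954326675686172053386858258780598238610644118262689860090681138802232529558282274233370724947176175349051123174185959021034773974476488572678987565805101192877296775047140165411066765168655166887186551078692852493973665583229772769379376376341757299489578793775132912349049392081623838483560532515906045445376762020520022728696285677638085689726193369095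
    10996907317744048201776382731410793802048645782714020512400457251596748538331474405450875867149761726668807828593098798500685399567041520875592067515910773144625994887707680655329453268887872566001049869710293550134396784388225273277393810974100352408645952997664904916665018199936076462352756316346531115833231102795548960297158953861983644576309807910385838015839817432914994830149465297667558118278755329800282526199791924049110177155763289310922145780207305530304719991902601452389002394240556070482319093715590199305710659362089203858894818256128697135336704349783707641415972881552705137805446667009282041271297772176773668639458687112781151112003585
    0 0 0 0
    17476812960910093116415553643038607475769422727538859698435345883453595921578515805074020101409391630199199827104863132372118377711217373100260828349392151649129991967532721802939827729739454261019365779391902838755689973495269266231357614844445969701082027837911901140448440856377157213906402498899827324358954326675686172053386858258780598238610644118262689860090681138802232529558282274233370724947176175349051123174185959021034773974476488572678987565805101192877296775047140165411066765168655166887186551078692852493973665583229772769379376376341757299489578793775132912349049392081623838483560532515906045445376762020520022728696285677638085689726193369095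
    3 (slot
      24973988401801099126757212263754654022441820624645715592022874292500933326433237072900733826387172755206855197486267273108338935099769992706523136 3) 0 = true := by
  decide +kernel

theorem no_bad3 {S : Set (Finset ℕ)} (hS : Bad S) (h : Finset.range 3 ∈ S) : False :=
  start_sound (tabOK3.tab (by
    have h := unit_blocks 35
    rwa [show ∑ i ∈ Finset.range 35, 2 ^ (64 * i) =
      10996907317744048201776382731410793802048645782714020512400457251596748538331474405450875867149761726668807828593098798500685399567041520875592067515910773144625994887707680655329453268887872566001049869710293550134396784388225273277393810974100352408645952997664904916665018199936076462352756316346531115833231102795548960297158953861983644576309807910385838015839817432914994830149465297667558118278755329800282526199791924049110177155763289310922145780207305530304719991902601452389002394240556070482319093715590199305710659362089203858894818256128697135336704349783707641415972881552705137805446667009282041271297772176773668639458687112781151112003585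
      by decide +kernel] at h)) hS
    (by norm_num) (by norm_num) (by decide +kernel) h search3

theorem tabOK4 : TabOK 35 35
    289297828928523131481145697825247594497937744846732725649075379267198876356417835964797756265367287840701730975857279322343139072941094758904703110600322086166405290743350760791136233407812556088949766469451146121699422887416000735922700489385334330192267107284976334923045842692703117328888600824438140768763396180521552567090462479357921566703466018736643588620918927000630368829733767887640748021079776451061655091648970303095759037601738103879683777015277903892906566246937589962729796979050264778605141847033094920324247807720287024199756722575083442050573196687669534928938233449430046142092037381992688926974752956692483494270297090369967331153942261192982543
    354235179651403256431737519934374929146103401961638234444447851378063473192762046660942062344440737755652228782455020252758602106425363593579269776715157512176083376579036009027427056293855951447835181512018377599352682808683205400102945858676114747661166579865056701699959383125392438367367355950597014835698512164256055185086624127334309875849219661703116031503375952738549197642165486409097824158837248971647347152446517891232187514945356188124298999850634591620694656057571288295945370745663040039991658257008820068460114882381688556317432830414374668211615403626971308058395147311160726491614146849765948285665576137694239094814870724736981048351028304202989603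
    24973988401801099126757172238881543675358680955779650405705279380323661851699270073258888289279374928990163547448907287434587744446270777029820416
    1319628878129285784210781353608391288553058382222500762079081503673912832716080608308691766407837780930215228915997573941824197992871907561518081528049156504408540754035623932926930368459498120156022299821461218608399391616627933908300146555593429733029628496310699355583915195458681533455774027143592132744622109402942529134284557570571289096236098202508783643639591846564520926984060204570996796099187404090113950149022605495833397962499654836385991236940195342464870069471971215534575360955296992371791647579035017417807960958953416280691286511452814321111029578201735708267222068688315253417907679748095193747636010573655245387472918021401900010533027855
    1231653619587333398594185717596200970443890104257606898570904479143441852525733347459978048922778730669180704426374793238830541153675636866012488276973321669098734771799888741559233432555297871399965105561191093609205144306388207979069145987138100145892735071469915237623868703724820337724370760130402536352296680432312357039118160653521203743344631051201037567782656247403307078398897416543661373675387647052574969873665100557438119760502539805221660905722143336094636013707656002693382586058332508749350675839027520995810600779651380467981145053989100257493530050044644969074882198648848898016284553597580917150619805420096568666994161550826086419071500295 := by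
  decide +kernel

theorem search4 : child (go
      289297828928523131481145697825247594497937744846732725649075379267198876356417835964797756265367287840701730975857279322343139072941094758904703110600322086166405290743350760791136233407812556088949766469451146121699422887416000735922700489385334330192267107284976334923045842692703117328888600824438140768763396180521552567090462479357921566703466018736643588620918927000630368829733767887640748021079776451061655091648970303095759037601738103879683777015277903892906566246937589962729796979050264778605141847033094920324247807720287024199756722575083442050573196687669534928938233449430046142092037381992688926974752956692483494270297090369967331153942261192982543
      10996907317744048201776382731410793802048645782714020512400457251596748538331474405450875867149761726668807828593098798500685399567041520875592067515910773144625994887707680655329453268887872566001049869710293550134396784388225273277393810974100352408645952997664904916665018199936076462352756316346531115833231102795548960297158953861983644576309807910385838015839817432914994830149465297667558118278755329800282526199791924049110177155763289310922145780207305530304719991902601452389002394240556070482319093715590199305710659362089203858894818256128697135336704349783707641415972881552705137805446667009282041271297772176773668639458687112781151112003585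
      354235179651403256431737519934374929146103401961638234444447851378063473192762046660942062344440737755652228782455020252758602106425363593579269776715157512176083376579036009027427056293855951447835181512018377599352682808683205400102945858676114747661166579865056701699959383125392438367367355950597014835698512164256055185086624127334309875849219661703116031503375952738549197642165486409097824158837248971647347152446517891232187514945356188124298999850634591620694656057571288295945370745663040039991658257008820068460114882381688556317432830414374668211615403626971308058395147311160726491614146849765948285665576137694239094814870724736981048351028304202989603
      24973988401801099126757172238881543675358680955779650405705279380323661851699270073258888289279374928990163547448907287434587744446270777029820416
      35 25)
    289297828928523131481145697825247594497937744846732725649075379267198876356417835964797756265367287840701730975857279322343139072941094758904703110600322086166405290743350760791136233407812556088949766469451146121699422887416000735922700489385334330192267107284976334923045842692703117328888600824438140768763396180521552567090462479357921566703466018736643588620918927000630368829733767887640748021079776451061655091648970303095759037601738103879683777015277903892906566246937589962729796979050264778605141847033094920324247807720287024199756722575083442050573196687669534928938233449430046142092037381992688926974752956692483494270297090369967331153942261192982543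
    10996907317744048201776382731410793802048645782714020512400457251596748538331474405450875867149761726668807828593098798500685399567041520875592067515910773144625994887707680655329453268887872566001049869710293550134396784388225273277393810974100352408645952997664904916665018199936076462352756316346531115833231102795548960297158953861983644576309807910385838015839817432914994830149465297667558118278755329800282526199791924049110177155763289310922145780207305530304719991902601452389002394240556070482319093715590199305710659362089203858894818256128697135336704349783707641415972881552705137805446667009282041271297772176773668639458687112781151112003585
    0 0 0 0
    289297828928523131481145697825247594497937744846732725649075379267198876356417835964797756265367287840701730975857279322343139072941094758904703110600322086166405290743350760791136233407812556088949766469451146121699422887416000735922700489385334330192267107284976334923045842692703117328888600824438140768763396180521552567090462479357921566703466018736643588620918927000630368829733767887640748021079776451061655091648970303095759037601738103879683777015277903892906566246937589962729796979050264778605141847033094920324247807720287024199756722575083442050573196687669534928938233449430046142092037381992688926974752956692483494270297090369967331153942261192982543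
    4 (slot
      24973988401801099126757172238881543675358680955779650405705279380323661851699270073258888289279374928990163547448907287434587744446270777029820416 4) 0 = true := by
  decide +kernel

theorem no_bad4 {S : Set (Finset ℕ)} (hS : Bad S) (h : Finset.range 4 ∈ S) : False :=
  start_sound (tabOK4.tab (by
    have h := unit_blocks 35
    rwa [show ∑ i ∈ Finset.range 35, 2 ^ (64 * i) =
      10996907317744048201776382731410793802048645782714020512400457251596748538331474405450875867149761726668807828593098798500685399567041520875592067515910773144625994887707680655329453268887872566001049869710293550134396784388225273277393810974100352408645952997664904916665018199936076462352756316346531115833231102795548960297158953861983644576309807910385838015839817432914994830149465297667558118278755329800282526199791924049110177155763289310922145780207305530304719991902601452389002394240556070482319093715590199305710659362089203858894818256128697135336704349783707641415972881552705137805446667009282041271297772176773668639458687112781151112003585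
      by decide +kernel] at h)) hS
    (by norm_num) (by norm_num) (by decide +kernel) h search4

theorem tabOK5 : TabOK 21 35
    559121178238572379034209240580217812775366173888159149605487216272881955102630019862974162620255470480927661492204327465340559894556256705974977659471896717914105847137944020952259432934009064092942540137328374374105334239013236825044727134760710439686878360754861422276049015217912634910007173118736360367803691305442673598584154569595419065633558359168274351820455987881522200879646977650851871
    20179412903318870402293656755730402452994772995902570931670747938250533888933757446128709361534822529057267819394220569547277782419378571515257686492882683998258806998233703099619399940525792558608460918028523382533813669677864259850067597397365405506095541776613312996411558257543767114486004974528841236605495697415648035290179457137338415414447910468643674032009571469027701938537827178032657233519164575122486249176598081301809696079120182909104356294680687280483775636134063083791246005546087703599807932483375538123650486127252990324104649006144592834390752901028906066627119397992656556713542359710564002548957482939669609930678528521754666730287171371075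
    1524290557495256286122407455362526970076463708922283102405967255120472609198992763646633878032544349550628809870096504849815944180576330711040
    2581167184276770972455128094084044192989677856040774960449978150915627246859814667639381401704366909985879892099532049335041181682546851492092399435388162101796887496989839663751551060077152831528796082304757641855954945795335653605279154910743508766226899181061563329406249771999567989399633212448657576738148407144295772794573518187258394465289721677498122478311416241537465504585744415
    1319628878129285784210781353608391288553058382222500762079081503673912832716080608308691766407837780930215228915997573941824197992871907561518081528049156504408540754035623932926930368459498120156022299821461218608399391616627933908300146555593429733029628496310699355583915195458681533455774027143592132744622109402942529134284557570571289096236098202508783643639591846564520926984060204570996796099187404090113950149022605495833397962499654836385991236940195342464870069471971215534575360955296992371791647579035017417807960958953416280691286511452814321111029578201735708267222068688315253417907679748095193747636010573655245387472918021401900010533027855 := by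
  decide +kernel

theorem search5 : child (go
      559121178238572379034209240580217812775366173888159149605487216272881955102630019862974162620255470480927661492204327465340559894556256705974977659471896717914105847137944020952259432934009064092942540137328374374105334239013236825044727134760710439686878360754861422276049015217912634910007173118736360367803691305442673598584154569595419065633558359168274351820455987881522200879646977650851871
      20815864389328798164978910924381867629797360486714762199165467201162334166037832870841687597205545420151422479276557647141784261178796259276090401114623550805273696779219680586165963622862524532556987526715631478952092709180121520193228225991267132644176201079196477282366298977860091200522286961229449695544360983818200623447904666682692540170885209816137411551283894036199041316945921
      20179412903318870402293656755730402452994772995902570931670747938250533888933757446128709361534822529057267819394220569547277782419378571515257686492882683998258806998233703099619399940525792558608460918028523382533813669677864259850067597397365405506095541776613312996411558257543767114486004974528841236605495697415648035290179457137338415414447910468643674032009571469027701938537827178032657233519164575122486249176598081301809696079120182909104356294680687280483775636134063083791246005546087703599807932483375538123650486127252990324104649006144592834390752901028906066627119397992656556713542359710564002548957482939669609930678528521754666730287171371075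
      1524290557495256286122407455362526970076463708922283102405967255120472609198992763646633878032544349550628809870096504849815944180576330711040
      35 25)
    559121178238572379034209240580217812775366173888159149605487216272881955102630019862974162620255470480927661492204327465340559894556256705974977659471896717914105847137944020952259432934009064092942540137328374374105334239013236825044727134760710439686878360754861422276049015217912634910007173118736360367803691305442673598584154569595419065633558359168274351820455987881522200879646977650851871
    20815864389328798164978910924381867629797360486714762199165467201162334166037832870841687597205545420151422479276557647141784261178796259276090401114623550805273696779219680586165963622862524532556987526715631478952092709180121520193228225991267132644176201079196477282366298977860091200522286961229449695544360983818200623447904666682692540170885209816137411551283894036199041316945921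
    0 0 0 0
    559121178238572379034209240580217812775366173888159149605487216272881955102630019862974162620255470480927661492204327465340559894556256705974977659471896717914105847137944020952259432934009064092942540137328374374105334239013236825044727134760710439686878360754861422276049015217912634910007173118736360367803691305442673598584154569595419065633558359168274351820455987881522200879646977650851871
    5 (slot
      1524290557495256286122407455362526970076463708922283102405967255120472609198992763646633878032544349550628809870096504849815944180576330711040 5) 0 = true := by
  decide +kernel

theorem no_bad5 {S : Set (Finset ℕ)} (hS : Bad S) (h : Finset.range 5 ∈ S) : False :=
  start_sound (tabOK5.tab (by
    have h := unit_blocks 21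
    rwa [show ∑ i ∈ Finset.range 21, 2 ^ (64 * i) =
      20815864389328798164978910924381867629797360486714762199165467201162334166037832870841687597205545420151422479276557647141784261178796259276090401114623550805273696779219680586165963622862524532556987526715631478952092709180121520193228225991267132644176201079196477282366298977860091200522286961229449695544360983818200623447904666682692540170885209816137411551283894036199041316945921
      by decide +kernel] at h)) hS
    (by norm_num) (by norm_num) (by decide +kernel) h search5

theorem tabOK6 : TabOK 7 21
    67825667818324743051474335712486411719703430581972894458864646426565505298485556575828893821038063877488058634511008661567
    1998322981375564623819920564426200147617519716369944423480317405438742112117305924121311973149370692357256179524566407542706600153941836475546253006367795317531808720287562144716946653037649349688983975697296367392668345330769131151999922912543412625131939323905180381254008149019951399161311235693850886594863124543303118717436217911400285986433742864470004422607415805369066963037323267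
    92308517985542075099803525607972970342124731847389537269554335035211655037069484555830509162419470036828254510250689513199701034824368128
    4964652780745704381014157432108209099753667288326030186524669240492122167128915176413938739687895089647481851377352767
    2581167184276770972455128094084044192989677856040774960449978150915627246859814667639381401704366909985879892099532049335041181682546851492092399435388162101796887496989839663751551060077152831528796082304757641855954945795335653605279154910743508766226899181061563329406249771999567989399633212448657576738148407144295772794573518187258394465289721677498122478311416241537465504585744415 := by
  decide +kernel

theorem search6 : child (go
      67825667818324743051474335712486411719703430581972894458864646426565505298485556575828893821038063877488058634511008661567
      39402006196394479214415027136064523887590553065872314977980846013346449130061698275692255149584597951633472719159297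
      1998322981375564623819920564426200147617519716369944423480317405438742112117305924121311973149370692357256179524566407542706600153941836475546253006367795317531808720287562144716946653037649349688983975697296367392668345330769131151999922912543412625131939323905180381254008149019951399161311235693850886594863124543303118717436217911400285986433742864470004422607415805369066963037323267
      92308517985542075099803525607972970342124731847389537269554335035211655037069484555830509162419470036828254510250689513199701034824368128
      21 25)
    67825667818324743051474335712486411719703430581972894458864646426565505298485556575828893821038063877488058634511008661567
    39402006196394479214415027136064523887590553065872314977980846013346449130061698275692255149584597951633472719159297
    0 0 0 0
    67825667818324743051474335712486411719703430581972894458864646426565505298485556575828893821038063877488058634511008661567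
    6 (slot
      92308517985542075099803525607972970342124731847389537269554335035211655037069484555830509162419470036828254510250689513199701034824368128 6) 0 = true := by
  decide +kernel

theorem no_bad6 {S : Set (Finset ℕ)} (hS : Bad S) (h : Finset.range 6 ∈ S) : False :=
  start_sound (tabOK6.tab (by
    have h := unit_blocks 7
    rwa [show ∑ i ∈ Finset.range 7, 2 ^ (64 * i) =
      39402006196394479214415027136064523887590553065872314977980846013346449130061698275692255149584597951633472719159297
      by decide +kernel] at h)) hS
    (by norm_num) (by norm_num) (by decide +kernel) h search6

theorem tabOK7 : TabOK 1 7
    127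
    39402006196394479214415027136064523887590553065872314977980846013346449130061698275692255149584597951633472719159297
    726838724295606890549323807888004534353641360687318060281490199180639288113397923326191050713763565560762521606266177933534601628614656
    127
    4964652780745704381014157432108209099753667288326030186524669240492122167128915176413938739687895089647481851377352767 := by
  decide +kernel

theorem search7 : child (go
      127
      1
      39402006196394479214415027136064523887590553065872314977980846013346449130061698275692255149584597951633472719159297
      726838724295606890549323807888004534353641360687318060281490199180639288113397923326191050713763565560762521606266177933534601628614656
      7 25)
    127
    1
    0 0 0 0
    127
    7 (slot
      726838724295606890549323807888004534353641360687318060281490199180639288113397923326191050713763565560762521606266177933534601628614656 7) 0 = true := by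
  decide +kernel

theorem no_bad7 {S : Set (Finset ℕ)} (hS : Bad S) (h : Finset.range 7 ∈ S) : False :=
  start_sound (tabOK7.tab (by
    have h := unit_blocks 1
    rwa [show ∑ i ∈ Finset.range 1, 2 ^ (64 * i) =
      1
      by decide +kernel] at h)) hS
    (by norm_num) (by norm_num) (by decide +kernel) h search7

end

end CollapseSearch

/-! ### Elementary collapses and acyclicity -/

namespace HomologySpheres

section Topology

variable {V : Type*} [DecidableEq V]

theorem mem_verts_iff {K : Finset (Finset V)} {v : V} : v ∈ verts K ↔ ∃ s ∈ K, v ∈ s := by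
  simp [verts, Finset.mem_sup]

theorem subset_verts {K : Finset (Finset V)} {s : Finset V} (hs : s ∈ K) : s ⊆ verts K :=
  fun _ hv => mem_verts_iff.2 ⟨s, hs, hv⟩

theorem verts_mono {K L : Finset (Finset V)} (h : L ⊆ K) : verts L ⊆ verts K :=
  Finset.sup_mono h

theorem z2bdry_subcomplex {K L : Finset (Finset V)} (h : L ⊆ K) {n : ℕ} {c : Finset V → ZMod 2}
    (hc : z2chainOK L n c) : z2bdry L c = z2bdry K c := by
  funext t
  unfold z2bdry
  apply Finset.sum_subset (Finset.sdiff_subset_sdiff (verts_mono h) (Finset.Subset.refl t))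
  intro v hv hv'
  by_contra hne
  rcases (hc _ hne).2 with h1 | h1
  · apply hv'
    rw [Finset.mem_sdiff] at hv ⊢
    exact ⟨mem_verts_iff.2 ⟨_, h1, Finset.mem_insert_self _ _⟩, hv.2⟩
  · exact absurd h1 (Finset.insert_ne_empty _ _)

theorem z2bdry_z2bdry (K : Finset (Finset V)) (c : Finset V → ZMod 2) :
    z2bdry K (z2bdry K c) = 0 := by
  funext t
  show ∑ v ∈ verts K \ t, ∑ w ∈ verts K \ insert v t, c (insert w (insert v t)) = 0
  rw [Finset.sum_sigma']
  refine Finset.sum_involution (fun a _ => ⟨a.2, a.1⟩) ?_ ?_ ?_ ?_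
  · rintro ⟨v, w⟩ _
    show c (insert w (insert v t)) + c (insert v (insert w t)) = 0
    rw [Finset.insert_comm]
    exact CharTwo.add_self_eq_zero _
  · rintro ⟨v, w⟩ h _ heq
    simp only [Finset.mem_sigma, Finset.mem_sdiff, Finset.mem_insert, not_or] at h
    exact h.2.2.1 (congrArg Sigma.fst heq)
  · rintro ⟨v, w⟩ h
    simp only [Finset.mem_sigma, Finset.mem_sdiff, Finset.mem_insert, not_or] at h ⊢
    exact ⟨⟨h.2.1, h.2.2.2⟩, h.1.1, fun hh => h.2.2.1 hh.symm, h.1.2⟩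
  · rintro ⟨v, w⟩ _
    rfl

theorem z2bdry_add (K : Finset (Finset V)) (c d : Finset V → ZMod 2) :
    z2bdry K (c + d) = z2bdry K c + z2bdry K d := by
  funext t
  simp only [z2bdry, Pi.add_apply, Finset.sum_add_distrib]

theorem zmod_two_eq_one {a : ZMod 2} : a ≠ 0 → a = 1 := by
  revert a; decide

theorem IsFreeFace.exists_insert {K : Finset (Finset V)} (hK : IsComplex K) {τ σ : Finset V}
    (h : IsFreeFace K τ σ) : ∃ x ∉ τ, x ∈ verts K ∧ insert x τ = σ := by
  obtain ⟨hτ, hσ, hτσ, hu⟩ := h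
  obtain ⟨x, hxσ, hxτ⟩ := Finset.exists_of_ssubset hτσ
  refine ⟨x, hxτ, subset_verts hσ hxσ, hu _ ?_ (Finset.ssubset_insert hxτ)⟩
  exact hK.2.2 σ hσ _ (Finset.insert_subset hxσ hτσ.1) (Finset.insert_nonempty _ _)

theorem IsFreeFace.isComplex {K : Finset (Finset V)} (hK : IsComplex K) {τ σ : Finset V}
    (h : IsFreeFace K τ σ) : IsComplex ((K.erase τ).erase σ) := by
  obtain ⟨x, hx, -, hxσ⟩ := h.exists_insert hK
  obtain ⟨hτ, hσ, hτσ, hu⟩ := h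
  have hτne : τ.Nonempty := by
    rw [Finset.nonempty_iff_ne_empty]; rintro rfl; exact hK.2.1 hτ
  refine ⟨⟨{x}, ?_⟩, ?_, ?_⟩
  · rw [Finset.mem_erase, Finset.mem_erase]
    refine ⟨?_, ?_, ?_⟩
    · intro he
      obtain ⟨y, hy⟩ := hτne
      have : y ∈ ({x} : Finset V) := by rw [he]; exact hτσ.1 hy
      rw [Finset.mem_singleton] at this
      subst this
      exact hx hy
    · rintro rfl
      exact hx (Finset.mem_singleton_self _)
    · refine hK.2.2 σ hσ _ ?_ (Finset.singleton_nonempty _)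
      rw [Finset.singleton_subset_iff, ← hxσ]
      exact Finset.mem_insert_self _ _
  · intro he
    exact hK.2.1 (Finset.mem_of_mem_erase (Finset.mem_of_mem_erase he))
  · intro s hs t hts ht
    rw [Finset.mem_erase, Finset.mem_erase] at hs ⊢
    refine ⟨?_, ?_, hK.2.2 s hs.2.2 t hts ht⟩
    · rintro rfl
      exact hs.1 (hu s hs.2.2 (lt_of_lt_of_le hτσ hts))
    · rintro rfl
      exact hs.1 (hu s hs.2.2 (lt_of_le_of_ne hts (fun he => hs.2.1 he.symm)))

theorem IsFreeFace.z2Acyclic {K : Finset (Finset V)} (hK : IsComplex K) {τ σ : Finset V}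
    (h : IsFreeFace K τ σ) (hac : Z2Acyclic K) : Z2Acyclic ((K.erase τ).erase σ) := by
  obtain ⟨x, hx, hxv, hxσ⟩ := h.exists_insert hK
  obtain ⟨hτ, hσ, hτσ, hu⟩ := h
  have hτne : τ ≠ ∅ := by rintro rfl; exact hK.2.1 hτ
  have hσne : σ ≠ ∅ := by rintro rfl; exact hK.2.1 hσ
  have hcard : σ.card = τ.card + 1 := by rw [← hxσ, Finset.card_insert_of_notMem hx]
  have hsub : (K.erase τ).erase σ ⊆ K :=
    (Finset.erase_subset _ _).trans (Finset.erase_subset _ _)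
  -- the boundary at `τ` only sees `σ`
  have hbτ : ∀ (n : ℕ) (c : Finset V → ZMod 2), z2chainOK K n c → z2bdry K c τ = c σ := by
    intro n c hc
    unfold z2bdry
    rw [Finset.sum_eq_single x, hxσ]
    · intro v hv hvx
      by_contra hne
      have hvτ := (Finset.mem_sdiff.1 hv).2
      rcases (hc _ hne).2 with h1 | h1
      · have h2 := hu _ h1 (Finset.ssubset_insert hvτ)
        have : v ∈ insert x τ := by rw [hxσ, ← h2]; exact Finset.mem_insert_self _ _
        rcases Finset.mem_insert.1 this with h3 | h3
        · exact hvx h3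
        · exact hvτ h3
      · exact absurd h1 (Finset.insert_ne_empty _ _)
    · intro h
      exact absurd (Finset.mem_sdiff.2 ⟨hxv, hx⟩) h
  have hrestrict : ∀ (n : ℕ) (c : Finset V → ZMod 2), z2chainOK K n c → c τ = 0 → c σ = 0 →
      z2chainOK ((K.erase τ).erase σ) n c := by
    intro n c hc h1 h2 s hs
    obtain ⟨h3, h4⟩ := hc s hs
    refine ⟨h3, ?_⟩
    rcases h4 with h4 | h4
    · left
      rw [Finset.mem_erase, Finset.mem_erase]
      refine ⟨?_, ?_, h4⟩
      · rintro rfl; exact hs h2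
      · rintro rfl; exact hs h1
    · exact Or.inr h4
  intro n c hc hbc
  have hcK : z2chainOK K n c := by
    intro s hs
    obtain ⟨h1, h2⟩ := hc s hs
    exact ⟨h1, h2.imp (fun h => hsub h) id⟩
  rw [z2bdry_subcomplex hsub hc] at hbc
  obtain ⟨d, hd, hbd⟩ := hac n c hcK hbc
  have hcτ : c τ = 0 := by
    by_contra hne
    rcases (hc _ hne).2 with h1 | h1
    · rw [Finset.mem_erase, Finset.mem_erase] at h1
      exact h1.2.1 rfl
    · exact hτne h1
  have hdσ : d σ = 0 := by rw [← hbτ _ d hd, hbd, hcτ]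
  by_cases hdτ : d τ = 0
  · have h1 := hrestrict _ d hd hdτ hdσ
    exact ⟨d, h1, by rw [z2bdry_subcomplex hsub h1, hbd]⟩
  · have hn : τ.card = n + 1 := (hd τ hdτ).1
    let u : Finset V → ZMod 2 := fun s => if s = σ then 1 else 0
    have hu1 : z2chainOK K (n + 2) u := by
      intro s hs
      have : s = σ := by
        by_contra hne
        exact hs (if_neg hne)
      subst this
      exact ⟨by omega, Or.inl hσ⟩
    have hbu : ∀ t, z2bdry K u t ≠ 0 → t.card = n + 1 ∧ t ⊆ σ := by
      intro t ht
      obtain ⟨v, hv, hne⟩ := Finset.exists_ne_zero_of_sum_ne_zero ht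
      have hs : insert v t = σ := by
        by_contra hh
        exact hne (if_neg hh)
      have hvt := (Finset.mem_sdiff.1 hv).2
      have h2 : (insert v t).card = t.card + 1 := Finset.card_insert_of_notMem hvt
      rw [hs] at h2
      exact ⟨by omega, by rw [← hs]; exact Finset.subset_insert _ _⟩
    have hbuτ : z2bdry K u τ = 1 := by
      rw [hbτ _ u hu1]
      exact if_pos rfl
    have hbuσ : z2bdry K u σ = 0 := by
      by_contra hne
      have := (hbu σ hne).1
      omega
    have hOK : z2chainOK K (n + 1) (d + z2bdry K u) := by
      intro s hs
      by_cases h1 : d s = 0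
      · have h2 : z2bdry K u s ≠ 0 := by
          intro h2
          apply hs
          rw [Pi.add_apply, h1, h2, add_zero]
        obtain ⟨h3, h4⟩ := hbu s h2
        refine ⟨h3, Or.inl (hK.2.2 σ hσ s h4 ?_)⟩
        rw [← Finset.card_pos]
        omega
      · exact hd s h1
    have h1 := hrestrict _ _ hOK (by
      rw [Pi.add_apply, zmod_two_eq_one hdτ, hbuτ]; decide) (by
      rw [Pi.add_apply, hdσ, hbuσ, add_zero])
    refine ⟨_, h1, ?_⟩
    rw [z2bdry_subcomplex hsub h1, z2bdry_add, hbd, z2bdry_z2bdry, add_zero]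

theorem image_inj_of_subset {W : Type*} [DecidableEq W] {A : Finset V} {f : V → W}
    (hf : Set.InjOn f A) {a b : Finset V} (ha : a ⊆ A) (hb : b ⊆ A)
    (h : a.image f = b.image f) : a = b := by
  have key : ∀ {a b : Finset V}, a ⊆ A → b ⊆ A → a.image f = b.image f → a ⊆ b := by
    intro a b ha hb h x hx
    have : f x ∈ b.image f := by rw [← h]; exact Finset.mem_image_of_mem f hx
    obtain ⟨y, hy, hyx⟩ := Finset.mem_image.1 this
    rwa [← hf (hb hy) (ha hx) hyx]
  exact Finset.Subset.antisymm (key ha hb h) (key hb ha h.symm)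

theorem image_erase_of_subset {W : Type*} [DecidableEq W] {A : Finset V} {f : V → W}
    (hf : Set.InjOn f A) {a : Finset V} (ha : a ⊆ A) {x : V} (hx : x ∈ a) :
    (a.image f).erase (f x) = (a.erase x).image f := by
  ext y
  simp only [Finset.mem_erase, Finset.mem_image]
  constructor
  · rintro ⟨hy, z, hz, rfl⟩
    exact ⟨z, ⟨fun h => hy (by rw [h]), hz⟩, rfl⟩
  · rintro ⟨z, ⟨hzx, hz⟩, rfl⟩
    exact ⟨fun h => hzx (hf (ha hz) (ha hx) h), z, hz, rfl⟩

theorem exists_labelling {A σ : Finset V} (hA : A.card ≤ 7) (hσ : σ ⊆ A) :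
    ∃ f : V → ℕ, Set.InjOn f A ∧ (∀ v ∈ A, f v < 7) ∧ σ.image f = Finset.range σ.card := by
  let l : List V := σ.toList ++ (A \ σ).toList
  have hmem : ∀ v ∈ A, v ∈ l := by
    intro v hv
    simp only [l, List.mem_append, Finset.mem_toList, Finset.mem_sdiff]
    tauto
  have hlen : l.length ≤ 7 := by
    simp only [l, List.length_append, Finset.length_toList]
    have := Finset.card_sdiff_add_card_eq_card hσ
    omega
  have hinj : Set.InjOn (fun v => l.idxOf v) A := by
    intro a ha b _ h
    exact (List.idxOf_inj (hmem a ha)).1 h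
  refine ⟨fun v => l.idxOf v, hinj, ?_, ?_⟩
  · intro v hv
    exact lt_of_lt_of_le (List.idxOf_lt_length_of_mem (hmem v hv)) hlen
  · apply Finset.eq_of_subset_of_card_le
    · intro y hy
      obtain ⟨v, hv, rfl⟩ := Finset.mem_image.1 hy
      rw [Finset.mem_range]
      have hv' : v ∈ σ.toList := Finset.mem_toList.2 hv
      show (σ.toList ++ (A \ σ).toList).idxOf v < _
      rw [List.idxOf_append_of_mem hv', ← Finset.length_toList]
      exact List.idxOf_lt_length_of_mem hv'
    · rw [Finset.card_range, Finset.card_image_of_injOn (hinj.mono (fun v hv => hσ hv))]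

theorem bad_of_no_free {K : Finset (Finset V)} (hK : IsComplex K) (hac : Z2Acyclic K)
    (hnf : ∀ τ σ, ¬ IsFreeFace K τ σ) {k : ℕ} (hk : 2 ≤ k) (hmax : ∀ s ∈ K, s.card ≤ k)
    {f : V → ℕ} (hf : Set.InjOn f (verts K)) (hf7 : ∀ v ∈ verts K, f v < 7) :
    CollapseSearch.Bad {s | ∃ r ∈ K, r.card = k ∧ s = r.image f} := by
  constructor
  · rintro s ⟨r, hr, -, rfl⟩ y hy
    obtain ⟨v, hv, rfl⟩ := Finset.mem_image.1 hy
    exact Finset.mem_range.2 (hf7 v (subset_verts hr hv))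
  · rw [linearIndepOn_iff']
    intro t g ht hsum
    let c : Finset V → ZMod 2 := fun r =>
      if r ∈ K ∧ r.card = k ∧ r.image f ∈ t then g (r.image f) else 0
    have hc0 : ∀ r, c r ≠ 0 → r ∈ K ∧ r.card = k ∧ r.image f ∈ t := by
      intro r hr
      by_contra hne
      exact hr (if_neg hne)
    have hc1 : ∀ r, r ∈ K ∧ r.card = k ∧ r.image f ∈ t → c r = g (r.image f) :=
      fun r hr => if_pos hr
    have hcOK : z2chainOK K k c := fun r hr => ⟨(hc0 r hr).2.1, Or.inl (hc0 r hr).1⟩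
    have hb : z2bdry K c = 0 := by
      funext τ
      rw [Pi.zero_apply]
      by_cases hτ : τ ⊆ verts K
      · have h0 := congrFun hsum (τ.image f)
        rw [Finset.sum_apply] at h0
        rw [Pi.zero_apply] at h0
        rw [← h0]
        unfold z2bdry
        refine Finset.sum_bij_ne_zero (fun v _ _ => (insert v τ).image f) ?_ ?_ ?_ ?_
        · intro v hv hne
          exact (hc0 _ hne).2.2
        · intro v hv hne w hw hne' h
          have h1 := image_inj_of_subset hf (subset_verts (hc0 _ hne).1)
            (subset_verts (hc0 _ hne').1) h
          have h2 : v ∈ insert w τ := by rw [← h1]; exact Finset.mem_insert_self _ _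
          rcases Finset.mem_insert.1 h2 with h3 | h3
          · exact h3
          · exact absurd h3 (Finset.mem_sdiff.1 hv).2
        · intro i hi hne
          obtain ⟨r, hr, hrk, rfl⟩ := ht hi
          rw [Pi.smul_apply, smul_eq_mul] at hne
          have hg := left_ne_zero_of_mul hne
          have hbd := right_ne_zero_of_mul hne
          have hex : ∃ x ∈ r.image f, (r.image f).erase x = τ.image f := by
            by_contra hh
            exact hbd (if_neg hh)
          obtain ⟨_, hx0, he⟩ := hex
          obtain ⟨x, hx, rfl⟩ := Finset.mem_image.1 hx0
          rw [image_erase_of_subset hf (subset_verts hr) hx] at he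
          have h1 := image_inj_of_subset hf
            ((Finset.erase_subset _ _).trans (subset_verts hr)) hτ he
          have h2 : insert x τ = r := by rw [← h1, Finset.insert_erase hx]
          refine ⟨x, ?_, ?_, ?_⟩
          · rw [Finset.mem_sdiff]
            refine ⟨subset_verts hr hx, ?_⟩
            rw [← h1]
            exact Finset.notMem_erase _ _
          · rw [h2, hc1 r ⟨hr, hrk, hi⟩]; exact hg
          · rw [h2]
        · intro v hv hne
          obtain ⟨h1, h2, h3⟩ := hc0 _ hne
          rw [hc1 _ ⟨h1, h2, h3⟩, Pi.smul_apply, smul_eq_mul]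
          have hbd : CollapseSearch.bd ((insert v τ).image f) (τ.image f) = 1 := by
            refine if_pos ⟨f v, Finset.mem_image_of_mem f (Finset.mem_insert_self _ _), ?_⟩
            rw [image_erase_of_subset hf (subset_verts h1) (Finset.mem_insert_self _ _),
              Finset.erase_insert (Finset.mem_sdiff.1 hv).2]
          rw [hbd, mul_one]
      · apply Finset.sum_eq_zero
        intro v _
        by_contra hne
        exact hτ ((Finset.subset_insert _ _).trans (subset_verts (hc0 _ hne).1))
    obtain ⟨d, hd, hbd⟩ := hac k c hcOK hb
    have hd0 : d = 0 := by
      funext s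
      by_contra hne
      obtain ⟨h1, h2 | h2⟩ := hd s hne
      · have := hmax s h2
        omega
      · rw [h2, Finset.card_empty] at h1
        omega
    intro i hi
    obtain ⟨r, hr, hrk, rfl⟩ := ht hi
    rw [← hc1 r ⟨hr, hrk, hi⟩, ← hbd, hd0]
    simp [z2bdry]
  · rintro s ⟨r, hr, hrk, rfl⟩ x' hx'
    obtain ⟨x, hx, rfl⟩ := Finset.mem_image.1 hx'
    have hcard : (r.erase x).card = k - 1 := by rw [Finset.card_erase_of_mem hx, hrk]
    have hτ : r.erase x ∈ K := hK.2.2 r hr _ (Finset.erase_subset _ _) (by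
      rw [← Finset.card_pos]; omega)
    have hex : ∃ ρ ∈ K, r.erase x ⊂ ρ ∧ ρ ≠ r := by
      by_contra hh
      push Not at hh
      exact hnf _ _ ⟨hτ, hr, Finset.erase_ssubset hx, hh⟩
    obtain ⟨ρ, hρ, hτρ, hρr⟩ := hex
    obtain ⟨y, hyρ, hyτ⟩ := Finset.exists_of_ssubset hτρ
    have hρe : insert y (r.erase x) = ρ := by
      apply Finset.eq_of_subset_of_card_le (Finset.insert_subset hyρ hτρ.1)
      rw [Finset.card_insert_of_notMem hyτ, hcard]
      have := hmax ρ hρ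
      omega
    have hyr : y ∉ r := by
      intro hy
      have : y = x := by
        by_contra hne
        exact hyτ (Finset.mem_erase.2 ⟨hne, hy⟩)
      subst this
      rw [Finset.insert_erase hx] at hρe
      exact hρr hρe.symm
    have hyv := subset_verts hρ hyρ
    refine ⟨f y, hf7 y hyv, ?_, ρ, hρ, ?_, ?_⟩
    · intro h
      obtain ⟨z, hz, hzy⟩ := Finset.mem_image.1 h
      have := hf (subset_verts hr hz) hyv hzy
      subst this
      exact hyr hz
    · rw [← hρe, Finset.card_insert_of_notMem hyτ, hcard]
      omega
    · rw [image_erase_of_subset hf (subset_verts hr) hx, ← Finset.image_insert, hρe]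

theorem eq_singleton_of_dim_zero {K : Finset (Finset V)} (hK : IsComplex K) (hac : Z2Acyclic K)
    (hmax : ∀ s ∈ K, s.card ≤ 1) : ∃ v, K = {{v}} := by
  have hsing : ∀ s ∈ K, ∃ v, s = {v} := by
    intro s hs
    rw [← Finset.card_eq_one]
    have h1 := hmax s hs
    have h2 : s.card ≠ 0 := by
      rw [Finset.card_ne_zero, Finset.nonempty_iff_ne_empty]
      rintro rfl
      exact hK.2.1 hs
    omega
  obtain ⟨σ, hσ⟩ := hK.1
  obtain ⟨v, rfl⟩ := hsing σ hσ
  refine ⟨v, ?_⟩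
  rw [Finset.eq_singleton_iff_unique_mem]
  refine ⟨hσ, ?_⟩
  intro s hs
  obtain ⟨u, rfl⟩ := hsing s hs
  by_contra huv
  let c : Finset V → ZMod 2 := fun t => (if t = {u} then 1 else 0) + (if t = {v} then 1 else 0)
  have hc0 : ∀ t, c t ≠ 0 → t = {u} ∨ t = {v} := by
    intro t ht
    by_contra hne
    rw [not_or] at hne
    apply ht
    show (if t = {u} then (1 : ZMod 2) else 0) + (if t = {v} then 1 else 0) = 0
    rw [if_neg hne.1, if_neg hne.2, add_zero]
  have hcOK : z2chainOK K 1 c := by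
    intro t ht
    rcases hc0 t ht with rfl | rfl
    · exact ⟨Finset.card_singleton _, Or.inl hs⟩
    · exact ⟨Finset.card_singleton _, Or.inl hσ⟩
  have hb : z2bdry K c = 0 := by
    funext t
    rw [Pi.zero_apply]
    by_cases ht : t = ∅
    · subst ht
      have hu : u ∈ verts K := subset_verts hs (Finset.mem_singleton_self u)
      have hv : v ∈ verts K := subset_verts hσ (Finset.mem_singleton_self v)
      simp only [z2bdry, c, Finset.sdiff_empty, insert_empty_eq, Finset.singleton_inj,
        Finset.sum_add_distrib, Finset.sum_ite_eq', hu, hv, if_true]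
      decide
    · apply Finset.sum_eq_zero
      intro w hw
      by_contra hne
      have hwt := (Finset.mem_sdiff.1 hw).2
      have h1 := Finset.card_insert_of_notMem hwt
      have h2 : (insert w t).card = 1 := (hcOK _ hne).1
      apply ht
      rw [← Finset.card_eq_zero]
      omega
  obtain ⟨d, hd, hbd⟩ := hac 1 c hcOK hb
  have hd0 : d = 0 := by
    funext s
    by_contra hne
    obtain ⟨h1, h2 | h2⟩ := hd s hne
    · have := hmax s h2
      omega
    · rw [h2, Finset.card_empty] at h1
      omega
  have h1 : c {u} = 0 := by
    rw [← hbd, hd0]; simp [z2bdry]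
  have h2 : c {u} = 1 := by
    show (if ({u} : Finset V) = {u} then (1 : ZMod 2) else 0) + (if {u} = {v} then 1 else 0) = 1
    rw [if_pos rfl, if_neg huv, add_zero]
  rw [h1] at h2
  exact absurd h2 (by decide)

theorem dim_zero_of_no_free {K : Finset (Finset V)} (hK : IsComplex K)
    (hcard : (verts K).card ≤ 7) (hac : Z2Acyclic K) (hnf : ∀ τ σ, ¬ IsFreeFace K τ σ) :
    ∀ s ∈ K, s.card ≤ 1 := by
  obtain ⟨σ, hσ, hmax⟩ := Finset.exists_max_image K Finset.card hK.1
  by_contra hne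
  have hk : 2 ≤ σ.card := by
    by_contra hlt
    apply hne
    intro s hs
    have := hmax s hs
    omega
  have hk7 : σ.card ≤ 7 := (Finset.card_le_card (subset_verts hσ)).trans hcard
  obtain ⟨f, hf, hf7, hfσ⟩ := exists_labelling hcard (subset_verts hσ)
  have hbad := bad_of_no_free hK hac hnf hk hmax hf hf7
  have hmem : Finset.range σ.card ∈ {s | ∃ r ∈ K, r.card = σ.card ∧ s = r.image f} :=
    ⟨σ, hσ, rfl, hfσ.symm⟩
  generalize σ.card = k at hk hk7 hbad hmem
  interval_cases k
  · exact CollapseSearch.no_bad2 hbad hmem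
  · exact CollapseSearch.no_bad3 hbad hmem
  · exact CollapseSearch.no_bad4 hbad hmem
  · exact CollapseSearch.no_bad5 hbad hmem
  · exact CollapseSearch.no_bad6 hbad hmem
  · exact CollapseSearch.no_bad7 hbad hmem

theorem collapsible_aux : ∀ (n : ℕ) (K : Finset (Finset V)), K.card = n → IsComplex K →
    (verts K).card ≤ 7 → Z2Acyclic K → Collapsible K := by
  intro n
  induction n using Nat.strong_induction_on with
  | _ n ih =>
  intro K hn hK hcard hac
  by_cases hfree : ∃ τ σ, IsFreeFace K τ σ
  · obtain ⟨τ, σ, h⟩ := hfree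
    have hsub : (K.erase τ).erase σ ⊆ K :=
      (Finset.erase_subset _ _).trans (Finset.erase_subset _ _)
    have hlt : ((K.erase τ).erase σ).card < n := by
      rw [← hn]
      exact lt_of_le_of_lt (Finset.card_le_card (Finset.erase_subset _ _))
        (Finset.card_erase_lt_of_mem h.1)
    obtain ⟨v, hv⟩ := ih _ hlt _ rfl (h.isComplex hK)
      ((Finset.card_le_card (verts_mono hsub)).trans hcard) (h.z2Acyclic hK hac)
    exact ⟨v, Relation.ReflTransGen.head ⟨τ, σ, h, rfl⟩ hv⟩
  · push Not at hfree
    obtain ⟨v, rfl⟩ := eq_singleton_of_dim_zero hK hac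
      (dim_zero_of_no_free hK hcard hac hfree)
    exact ⟨v, Relation.ReflTransGen.refl⟩

end Topology

end HomologySpheres

noncomputable section

attribute [local instance] Classical.propDecidable

namespace HomologySpheres

variable {V : Type*} [DecidableEq V] {W : Type*} [DecidableEq W]

/-- Theorem 1: Every `ℤ/2`-acyclic simplicial complex with at
most 7 vertices is collapsible. -/
theorem z2acyclic_le_seven_vertices_collapsible {V : Type*} [DecidableEq V]
    (K : Finset (Finset V)) (hK : IsComplex K)
    (hcard : (verts K).card ≤ 7) (hac : Z2Acyclic K) :
    Collapsible K := by
  exact collapsible_aux _ K rfl hK hcard hac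

end HomologySpheres
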